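/- A tree T of order n(T) ≥ 2 satisfies γ_t^{oi}(S(T)) = (4n(T) − l(T) + s(T) − 2)/3 if and only if T belongs to the family 𝒯. -/

import Mathlib

open SimpleGraph

universe u

/-- A total outer-independent dominating set: every vertex has a neighbor in `D`,
and the complement of `D` is an independent set. -/
def IsTOIDS {V : Type u} (G : SimpleGraph V) (D : Set V) : Prop :=
  (∀ v : V, ∃ u ∈ D, G.Adj v u) ∧ ∀ u ∉ D, ∀ w ∉ D, ¬ G.Adj u w

/-- The total outer-independent domination number. -/
noncomputable def toidNumber {V : Type u} (G : SimpleGraph V) : ℕ :=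
  sInf {n : ℕ | ∃ D : Set V, IsTOIDS G D ∧ D.ncard = n}

/-- The subdivision graph: each edge is replaced by a new vertex adjacent exactly to
its two endpoints. -/
def subdivision {V : Type u} (G : SimpleGraph V) : SimpleGraph (V ⊕ G.edgeSet) :=
  SimpleGraph.fromRel fun x y =>
    ∃ (v : V) (e : G.edgeSet), x = Sum.inl v ∧ y = Sum.inr e ∧ v ∈ (e : Sym2 V)

/-- A leaf: a vertex with exactly one neighbor. -/
def IsLeafVert {V : Type u} (G : SimpleGraph V) (v : V) : Prop := ∃! u, G.Adj v u

/-- A support vertex: a vertex adjacent to a leaf. -/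
def IsSupportVert {V : Type u} (G : SimpleGraph V) (v : V) : Prop :=
  ∃ u, G.Adj v u ∧ IsLeafVert G u

/-- A strong support vertex: a vertex adjacent to at least two leaves. -/
def IsStrongSupportVert {V : Type u} (G : SimpleGraph V) (v : V) : Prop :=
  ∃ u w, u ≠ w ∧ G.Adj v u ∧ G.Adj v w ∧ IsLeafVert G u ∧ IsLeafVert G w

/-- A strong leaf: a leaf adjacent to a strong support vertex. -/
def IsStrongLeaf {V : Type u} (G : SimpleGraph V) (v : V) : Prop :=
  IsLeafVert G v ∧ ∃ u, G.Adj v u ∧ IsStrongSupportVert G u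

/-- A weak leaf: a leaf that is not a strong leaf. -/
def IsWeakLeaf {V : Type u} (G : SimpleGraph V) (v : V) : Prop :=
  IsLeafVert G v ∧ ¬ IsStrongLeaf G v

/-- A semi-support vertex: neither a leaf nor a support vertex, but adjacent to a
support vertex. -/
def IsSemiSupportVert {V : Type u} (G : SimpleGraph V) (v : V) : Prop :=
  ¬ IsLeafVert G v ∧ ¬ IsSupportVert G v ∧ ∃ u, G.Adj v u ∧ IsSupportVert G u

/-- The number of leaves, with the convention that `P₂` has exactly one leaf. -/
noncomputable def leafCount {V : Type u} (G : SimpleGraph V) : ℕ :=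
  if Nat.card V = 2 then 1 else {v | IsLeafVert G v}.ncard

/-- The number of support vertices, with the convention that `P₂` has exactly one
support vertex. -/
noncomputable def supportCount {V : Type u} (G : SimpleGraph V) : ℕ :=
  if Nat.card V = 2 then 1 else {v | IsSupportVert G v}.ncard

/-- The graph obtained from `G` by attaching a path `P_r` to the vertex `v`:
the new vertices form a path `p₀ p₁ ⋯ p_{r-1}` and `v` is joined to the end `p₀`. -/
def attachPath {V : Type u} (G : SimpleGraph V) (v : V) (r : ℕ) :
    SimpleGraph (V ⊕ Fin r) :=
  SimpleGraph.fromRel fun x y =>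
    (∃ a b, x = Sum.inl a ∧ y = Sum.inl b ∧ G.Adj a b) ∨
    (∃ i j : Fin r, x = Sum.inr i ∧ y = Sum.inr j ∧ (j : ℕ) = (i : ℕ) + 1) ∨
    (∃ i : Fin r, x = Sum.inl v ∧ y = Sum.inr i ∧ (i : ℕ) = 0)

/-- The graph obtained from `G` by adding a disjoint copy of the tree `Q_r`
(`r` paths `P₃` joined to a central vertex) and identifying the central vertex
of `Q_r` with the vertex `v` of `G`. -/
def attachQ {V : Type u} (G : SimpleGraph V) (v : V) (r : ℕ) :
    SimpleGraph (V ⊕ Fin r × Fin 3) :=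
  SimpleGraph.fromRel fun x y =>
    (∃ a b, x = Sum.inl a ∧ y = Sum.inl b ∧ G.Adj a b) ∨
    (∃ i : Fin r, x = Sum.inl v ∧ y = Sum.inr (i, 0)) ∨
    (∃ (i : Fin r) (j k : Fin 3),
      x = Sum.inr (i, j) ∧ y = Sum.inr (i, k) ∧ (k : ℕ) = (j : ℕ) + 1)

/-- The family `F`: all trees obtainable from `P₂` by repeatedly
(F1) attaching `P₁` to a support vertex, (F2) attaching `P₂` to a support or
semi-support vertex, (F3) attaching `P₃` to a weak leaf. -/
inductive InFamilyF : {W : Type u} → SimpleGraph W → Prop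
  | base {W : Type u} (G : SimpleGraph W) (e : G ≃g SimpleGraph.pathGraph 2) :
      InFamilyF G
  | op1 {W : Type u} {G' : SimpleGraph W} {v : W} (hv : IsSupportVert G' v)
      (hF : InFamilyF G') {U : Type u} (G : SimpleGraph U)
      (e : G ≃g attachPath G' v 1) : InFamilyF G
  | op2 {W : Type u} {G' : SimpleGraph W} {v : W}
      (hv : IsSupportVert G' v ∨ IsSemiSupportVert G' v)
      (hF : InFamilyF G') {U : Type u} (G : SimpleGraph U)
      (e : G ≃g attachPath G' v 2) : InFamilyF G
  | op3 {W : Type u} {G' : SimpleGraph W} {v : W} (hv : IsWeakLeaf G' v)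
      (hF : InFamilyF G') {U : Type u} (G : SimpleGraph U)
      (e : G ≃g attachPath G' v 3) : InFamilyF G

/-- The family `𝒯`: all trees obtainable from `P₂` by repeatedly
(O1) attaching `P₁` to a support vertex, (O2) attaching `P₃` to a support vertex or a
weak leaf, (O3) adding a copy of `Q_r` (`r ≥ 2`) identifying its central vertex with a
weak leaf. -/
inductive InFamilyT : {W : Type u} → SimpleGraph W → Prop
  | base {W : Type u} (G : SimpleGraph W) (e : G ≃g SimpleGraph.pathGraph 2) :
      InFamilyT G
  | op1 {W : Type u} {G' : SimpleGraph W} {v : W} (hv : IsSupportVert G' v)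
      (hF : InFamilyT G') {U : Type u} (G : SimpleGraph U)
      (e : G ≃g attachPath G' v 1) : InFamilyT G
  | op2 {W : Type u} {G' : SimpleGraph W} {v : W}
      (hv : IsSupportVert G' v ∨ IsWeakLeaf G' v)
      (hF : InFamilyT G') {U : Type u} (G : SimpleGraph U)
      (e : G ≃g attachPath G' v 3) : InFamilyT G
  | op3 {W : Type u} {G' : SimpleGraph W} {v : W} (hv : IsWeakLeaf G' v)
      (hF : InFamilyT G') {r : ℕ} (hr : 2 ≤ r) {U : Type u} (G : SimpleGraph U)
      (e : G ≃g attachQ G' v r) : InFamilyT G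

/-- A total outer-independent dominating set of the subdivision of `G`, split into a set `C` of
vertices and a set `F` of edges, where the vertices in `X` need not be dominated. -/
structure SemiDom {V : Type*} (G : SimpleGraph V) (X C : Set V) (F : Set (Sym2 V)) : Prop where
  sub : F ⊆ G.edgeSet
  dom : ∀ v ∉ X, ∃ u, s(v, u) ∈ F
  cov : ∀ u w, G.Adj u w → u ∈ C ∨ w ∈ C
  ind : ∀ u w, G.Adj u w → u ∈ C ∨ s(u, w) ∈ F

theorem subdivision_adj_inl_inr {V : Type u} {G : SimpleGraph V} {v : V} {e : G.edgeSet} :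
    (subdivision G).Adj (Sum.inl v) (Sum.inr e) ↔ v ∈ (e : Sym2 V) := by
  simp [subdivision]

theorem subdivision_adj_inr_inl {V : Type u} {G : SimpleGraph V} {v : V} {e : G.edgeSet} :
    (subdivision G).Adj (Sum.inr e) (Sum.inl v) ↔ v ∈ (e : Sym2 V) := by
  simp [subdivision]

theorem subdivision_not_adj_inl_inl {V : Type u} {G : SimpleGraph V} {v w : V} :
    ¬ (subdivision G).Adj (Sum.inl v) (Sum.inl w) := by
  simp [subdivision]

theorem subdivision_not_adj_inr_inr {V : Type u} {G : SimpleGraph V} {e f : G.edgeSet} :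
    ¬ (subdivision G).Adj (Sum.inr e) (Sum.inr f) := by
  simp [subdivision]

theorem isTOIDS_subdivision_iff {V : Type u} {G : SimpleGraph V} {D : Set (V ⊕ G.edgeSet)} :
    IsTOIDS (subdivision G) D ↔
      SemiDom G ∅ (Sum.inl ⁻¹' D) (Subtype.val '' (Sum.inr ⁻¹' D : Set G.edgeSet)) := by
  constructor
  · rintro ⟨hd, hi⟩
    refine ⟨by rintro _ ⟨e, -, rfl⟩; exact e.2, fun v _ => ?_, fun u w h => ?_, fun u w h => ?_⟩
    · obtain ⟨x | e, hx, hadj⟩ := hd (Sum.inl v)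
      · exact absurd hadj subdivision_not_adj_inl_inl
      · obtain ⟨u, hu⟩ := Sym2.mem_iff_exists.1 (subdivision_adj_inl_inr.1 hadj)
        exact ⟨u, e, hx, hu⟩
    · obtain ⟨x | e, hx, hadj⟩ := hd (Sum.inr ⟨s(u, w), h⟩)
      · rcases Sym2.mem_iff.1 (subdivision_adj_inr_inl.1 hadj) with rfl | rfl
        · exact Or.inl hx
        · exact Or.inr hx
      · exact absurd hadj subdivision_not_adj_inr_inr
    · by_contra! hc
      refine hi (Sum.inl u) hc.1 (Sum.inr ⟨s(u, w), h⟩) (fun hm => hc.2 ⟨_, hm, rfl⟩) ?_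
      exact subdivision_adj_inl_inr.2 (by simp)
  · rintro ⟨-, hd, hc, hi⟩
    refine ⟨?_, ?_⟩
    · rintro (v | ⟨e, he⟩)
      · obtain ⟨u, e, he, heq⟩ := hd v (by simp)
        exact ⟨Sum.inr e, he, subdivision_adj_inl_inr.2 (by rw [heq]; simp)⟩
      · induction e with
        | h u w =>
          rcases hc u w he with h | h
          · exact ⟨Sum.inl u, h, subdivision_adj_inr_inl.2 (by simp)⟩
          · exact ⟨Sum.inl w, h, subdivision_adj_inr_inl.2 (by simp)⟩
    · have key : ∀ (v : V) (e : G.edgeSet), Sum.inl v ∉ D → Sum.inr e ∉ D → v ∉ (e : Sym2 V) := by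
        intro v e hv he hve
        obtain ⟨w, hw⟩ := Sym2.mem_iff_exists.1 hve
        have hadj : G.Adj v w := by rw [← mem_edgeSet, ← hw]; exact e.2
        rcases hi v w hadj with h | ⟨f, hf, hfe⟩
        · exact hv h
        · exact he (by rwa [← Subtype.ext (hfe.trans hw.symm)])
      rintro (u | e) hu (w | f) hw hadj
      · exact subdivision_not_adj_inl_inl hadj
      · exact key _ _ hu hw (subdivision_adj_inl_inr.1 hadj)
      · exact key _ _ hw hu (subdivision_adj_inr_inl.1 hadj)
      · exact subdivision_not_adj_inr_inr hadj

theorem ncard_sum_eq {α β : Type*} [Finite α] [Finite β] (D : Set (α ⊕ β)) :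
    D.ncard = (Sum.inl ⁻¹' D).ncard + (Sum.inr ⁻¹' D).ncard := by
  rw [← Set.ncard_image_of_injective (Sum.inl ⁻¹' D) Sum.inl_injective,
    ← Set.ncard_image_of_injective (Sum.inr ⁻¹' D) Sum.inr_injective,
    ← Set.ncard_union_eq (s := Sum.inl '' (Sum.inl ⁻¹' D)),
    Set.image_preimage_inl_union_image_preimage_inr]
  rw [Set.disjoint_left]
  rintro _ ⟨a, -, rfl⟩ ⟨b, -, h⟩
  cases h

/-- The total outer-independent domination number of the subdivision. -/
noncomputable def subToid {V : Type u} (G : SimpleGraph V) : ℕ := toidNumber (subdivision G)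

theorem subToid_le {V : Type u} [Finite V] {G : SimpleGraph V} {C : Set V} {F : Set (Sym2 V)}
    (h : SemiDom G ∅ C F) : subToid G ≤ C.ncard + F.ncard := by
  let D : Set (V ⊕ G.edgeSet) := Sum.inl '' C ∪ Sum.inr '' (Subtype.val ⁻¹' F)
  have h1 : Sum.inl ⁻¹' D = C := by ext; simp [D]
  have h2 : (Subtype.val '' (Sum.inr ⁻¹' D : Set G.edgeSet)) = F := by
    ext e
    simp only [D, Set.mem_image, Set.mem_preimage, Set.mem_union, reduceCtorEq, and_false,
      exists_false, false_or, Sum.inr.injEq, exists_eq_right, Subtype.exists, exists_and_left]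
    exact ⟨by rintro ⟨_, h, -, rfl⟩; exact h, fun he => ⟨e, he, h.sub he, rfl⟩⟩
  refine Nat.sInf_le ⟨D, ?_, ?_⟩
  · rw [isTOIDS_subdivision_iff, h1, h2]
    exact h
  · rw [ncard_sum_eq, h1, ← h2, Set.ncard_image_of_injective _ Subtype.val_injective]

/-- A graph without isolated vertices. -/
def NoIsolated {V : Type*} (G : SimpleGraph V) : Prop := ∀ v, ∃ u, G.Adj v u

theorem exists_subToid {V : Type u} [Finite V] {G : SimpleGraph V} (hG : NoIsolated G) :
    ∃ C F, SemiDom G ∅ C F ∧ subToid G = C.ncard + F.ncard := by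
  have hne : {n : ℕ | ∃ D, IsTOIDS (subdivision G) D ∧ D.ncard = n}.Nonempty := by
    refine ⟨_, Set.univ, isTOIDS_subdivision_iff.2 ⟨?_, ?_, ?_, ?_⟩, rfl⟩
    · rintro _ ⟨e, -, rfl⟩; exact e.2
    · intro v _
      obtain ⟨u, hu⟩ := hG v
      exact ⟨u, ⟨_, hu⟩, trivial, rfl⟩
    · exact fun _ _ _ => Or.inl trivial
    · exact fun _ _ _ => Or.inl trivial
  obtain ⟨D, hD, hn⟩ := Nat.sInf_mem hne
  refine ⟨_, _, isTOIDS_subdivision_iff.1 hD, ?_⟩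
  rw [subToid, toidNumber, ← hn, ncard_sum_eq,
    Set.ncard_image_of_injective _ Subtype.val_injective]

section Swaps

variable {V : Type u} {G : SimpleGraph V}

theorem IsLeafVert.eq {v a b : V} (h : IsLeafVert G v) (ha : G.Adj v a) (hb : G.Adj v b) : a = b :=
  h.unique ha hb

theorem isLeafVert_of {v a : V} (ha : G.Adj v a) (h : ∀ b, G.Adj v b → b = a) : IsLeafVert G v :=
  ⟨a, ha, h⟩

theorem not_isLeafVert_of {v a b : V} (ha : G.Adj v a) (hb : G.Adj v b) (h : a ≠ b) :
    ¬ IsLeafVert G v := fun hl => h (hl.eq ha hb)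

theorem SemiDom.mono {X Y C : Set V} {F : Set (Sym2 V)} (h : SemiDom G X C F) (hXY : X ⊆ Y) :
    SemiDom G Y C F :=
  ⟨h.sub, fun v hv => h.dom v fun hx => hv (hXY hx), h.cov, h.ind⟩

theorem SemiDom.adj {X C : Set V} {F : Set (Sym2 V)} (h : SemiDom G X C F) {a b : V}
    (hab : s(a, b) ∈ F) : G.Adj a b := h.sub hab

theorem SemiDom.leaf_edge {X C : Set V} {F : Set (Sym2 V)} (h : SemiDom G X C F) {v z : V}
    (hz : IsLeafVert G z) (hzX : z ∉ X) (hvz : G.Adj v z) : s(v, z) ∈ F := by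
  obtain ⟨u, hu⟩ := h.dom z hzX
  rw [hz.eq hvz.symm (h.adj hu), Sym2.eq_swap]
  exact hu

variable [Finite V]

theorem ncard_insert_sdiff_le {α : Type*} [Finite α] {C : Set α} {v z : α} (hz : z ∈ C) :
    (insert v (C \ {z})).ncard ≤ C.ncard := by
  have := Set.ncard_insert_le v (C \ {z})
  have := Set.ncard_sdiff_singleton_add_one hz
  omega

theorem SemiDom.swap_leaf {C : Set V} {F : Set (Sym2 V)} (h : SemiDom G ∅ C F) {v z : V}
    (hz : IsLeafVert G z) (hvz : G.Adj v z) (hv : v ∉ C) :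
    SemiDom G ∅ (insert v (C \ {z})) F ∧
      (insert v (C \ {z})).ncard + F.ncard ≤ C.ncard + F.ncard := by
  have hzC : z ∈ C := (h.cov v z hvz).resolve_left hv
  refine ⟨⟨h.sub, h.dom, fun a b hab => ?_, fun a b hab => ?_⟩, ?_⟩
  · by_cases ha : a = z
    · subst ha
      exact Or.inr (Or.inl (hz.eq hab hvz.symm))
    · by_cases hb : b = z
      · subst hb
        exact Or.inl (Or.inl (hz.eq hab.symm hvz.symm))
      · rcases h.cov a b hab with h | h
        · exact Or.inl (Or.inr ⟨h, ha⟩)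
        · exact Or.inr (Or.inr ⟨h, hb⟩)
  · by_cases ha : a = z
    · subst ha
      have := h.leaf_edge hz (by simp) hab.symm
      exact Or.inr (by rwa [Sym2.eq_swap])
    · rcases h.ind a b hab with h | h
      · exact Or.inl (Or.inr ⟨h, ha⟩)
      · exact Or.inr h
  · exact Nat.add_le_add_right (ncard_insert_sdiff_le hzC) _

/-- Some minimum solution contains a given support vertex. -/
theorem exists_subToid_mem_support (hG : NoIsolated G) {v : V} (hv : IsSupportVert G v) :
    ∃ C F, SemiDom G ∅ C F ∧ C.ncard + F.ncard ≤ subToid G ∧ v ∈ C := by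
  obtain ⟨C, F, h, hc⟩ := exists_subToid hG
  obtain ⟨z, hvz, hz⟩ := hv
  by_cases hvC : v ∈ C
  · exact ⟨C, F, h, hc.ge, hvC⟩
  · obtain ⟨h1, h2⟩ := h.swap_leaf hz hvz hvC
    exact ⟨_, _, h1, h2.trans hc.ge, Or.inl rfl⟩

/-- Some minimum solution contains a given vertex of degree at least two carrying a pendant
path on two vertices. -/
theorem exists_subToid_mem_pendant (hG : NoIsolated G) {v x y z : V} (hvx : G.Adj v x)
    (hvy : G.Adj v y) (hxy : x ≠ y) (hyz : G.Adj y z) (hz : IsLeafVert G z)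
    (hy : ∀ a, G.Adj y a → a = v ∨ a = z) (hvz : v ≠ z) :
    ∃ C F, SemiDom G ∅ C F ∧ C.ncard + F.ncard ≤ subToid G ∧ v ∈ C := by
  obtain ⟨C, F, h, hc⟩ := exists_subToid hG
  by_cases hvC : v ∈ C
  · exact ⟨C, F, h, hc.ge, hvC⟩
  have hyC : y ∈ C := (h.cov v y hvy).resolve_left hvC
  have hyF : s(v, y) ∈ F := (h.ind v y hvy).resolve_left hvC
  have hxF : s(v, x) ∈ F := (h.ind v x hvx).resolve_left hvC
  refine ⟨insert v C, F \ {s(v, y)}, ⟨?_, ?_, ?_, ?_⟩, ?_, Or.inl rfl⟩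
  · exact Set.sdiff_subset.trans h.sub
  · intro a _
    by_cases hav : a = v
    · subst hav
      exact ⟨x, hxF, by simp [hxy, hvx.ne']⟩
    by_cases hay : a = y
    · subst hay
      refine ⟨z, h.leaf_edge hz (by simp) hyz, ?_⟩
      simp [hvz.symm, hvy.ne', hyz.ne']
    · obtain ⟨u, hu⟩ := h.dom a (by simp)
      refine ⟨u, hu, ?_⟩
      simp [hav, hay]
  · intro a b hab
    exact (h.cov a b hab).imp Or.inr Or.inr
  · intro a b hab
    rcases h.ind a b hab with h | h
    · exact Or.inl (Or.inr h)
    · by_cases he : s(a, b) = s(v, y)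
      · rcases Sym2.eq_iff.1 he with ⟨rfl, -⟩ | ⟨rfl, -⟩
        · exact Or.inl (Or.inl rfl)
        · exact Or.inl (Or.inr hyC)
      · exact Or.inr ⟨h, he⟩
  · have := Set.ncard_insert_le v C
    have := Set.ncard_sdiff_singleton_add_one hyF
    omega

/-- For a support vertex or a leaf `v`, leaving `v` undominated does not reduce the cost. -/
theorem SemiDom.repair (hG : NoIsolated G) {v : V} (hv : IsSupportVert G v ∨ IsLeafVert G v)
    {C : Set V} {F : Set (Sym2 V)} (h : SemiDom G {v} C F) : subToid G ≤ C.ncard + F.ncard := by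
  by_cases hd : ∃ u, s(v, u) ∈ F
  · refine subToid_le ⟨h.sub, fun a _ => ?_, h.cov, h.ind⟩
    by_cases ha : a = v
    · rwa [ha]
    · exact h.dom a ha
  rcases hv with ⟨z, hvz, hz⟩ | hv
  · exact absurd ⟨z, h.leaf_edge hz hvz.ne' hvz⟩ hd
  push Not at hd
  obtain ⟨u, hu⟩ := hG v
  have hvC : v ∈ C := (h.ind v u hu).resolve_right (hd u)
  have huC : u ∈ C := (h.ind u v hu.symm).resolve_right (by rw [Sym2.eq_swap]; exact hd u)
  have key : SemiDom G ∅ (C \ {v}) (insert s(v, u) F) := by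
    refine ⟨Set.insert_subset hu h.sub, fun a _ => ?_, fun a b hab => ?_, fun a b hab => ?_⟩
    · by_cases ha : a = v
      · exact ⟨u, Or.inl (by rw [ha])⟩
      · obtain ⟨b, hb⟩ := h.dom a ha
        exact ⟨b, Or.inr hb⟩
    · by_cases ha : a = v
      · subst ha
        rw [hv.eq hab hu]
        exact Or.inr ⟨huC, hu.ne'⟩
      by_cases hb : b = v
      · subst hb
        rw [hv.eq hab.symm hu]
        exact Or.inl ⟨huC, hu.ne'⟩
      · exact (h.cov a b hab).imp (fun h => ⟨h, ha⟩) (fun h => ⟨h, hb⟩)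
    · by_cases ha : a = v
      · subst ha
        rw [hv.eq hab hu]
        exact Or.inr (Or.inl rfl)
      · exact (h.ind a b hab).imp (fun h => ⟨h, ha⟩) Or.inr
  have := subToid_le key
  have := Set.ncard_insert_le s(v, u) F
  have := Set.ncard_sdiff_singleton_add_one hvC
  omega

end Swaps

/-- `T` arises from `G` by adding a disjoint copy of `H` (embedded through `p`) and joining the
vertex `v` of `G` (embedded through `φ`) to all vertices of `H` satisfying `r`. -/
structure Att {V W : Type u} {ι : Type*} (H : SimpleGraph ι) (r : ι → Prop) (G : SimpleGraph V)
    (v : V) (T : SimpleGraph W) (φ : V → W) (p : ι → W) : Prop where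
  bij : Function.Bijective (Sum.elim φ p)
  adj_old : ∀ a b, T.Adj (φ a) (φ b) ↔ G.Adj a b
  adj_new : ∀ i j, T.Adj (p i) (p j) ↔ H.Adj i j
  adj_mix : ∀ a i, T.Adj (φ a) (p i) ↔ a = v ∧ r i

namespace Att

variable {V W : Type u} {ι : Type*} {H : SimpleGraph ι} {r : ι → Prop} {G : SimpleGraph V}
  {v : V} {T : SimpleGraph W} {φ : V → W} {p : ι → W}

section Basic

variable (h : Att H r G v T φ p)
include h

theorem inj_old : Function.Injective φ := fun a b hab =>
  Sum.inl_injective (h.bij.1 (a₁ := Sum.inl a) (a₂ := Sum.inl b) hab)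

theorem inj_new : Function.Injective p := fun a b hab =>
  Sum.inr_injective (h.bij.1 (a₁ := Sum.inr a) (a₂ := Sum.inr b) hab)

theorem ne (a : V) (i : ι) : φ a ≠ p i := fun hab => by
  cases h.bij.1 (a₁ := Sum.inl a) (a₂ := Sum.inr i) hab

theorem cover (w : W) : (∃ a, φ a = w) ∨ ∃ i, p i = w := by
  obtain ⟨a | i, hw⟩ := h.bij.2 w
  · exact Or.inl ⟨a, hw⟩
  · exact Or.inr ⟨i, hw⟩

theorem adj_mix' (a : V) (i : ι) : T.Adj (p i) (φ a) ↔ a = v ∧ r i := by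
  rw [T.adj_comm, h.adj_mix]

theorem finite_old [Finite W] : Finite V := Finite.of_injective φ h.inj_old

theorem finite_new [Finite W] : Finite ι := Finite.of_injective p h.inj_new

theorem finite [Finite V] [Finite ι] : Finite W := Finite.of_surjective _ h.bij.2

theorem card [Finite V] [Finite ι] : Nat.card W = Nat.card V + Nat.card ι := by
  rw [← Nat.card_congr (Equiv.ofBijective _ h.bij), Nat.card_sum]

theorem noIsolated (hG : NoIsolated G) (hH : ∀ i, r i ∨ ∃ j, H.Adj i j) : NoIsolated T := by
  intro w
  rcases h.cover w with ⟨a, rfl⟩ | ⟨i, rfl⟩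
  · obtain ⟨b, hb⟩ := hG a
    exact ⟨φ b, (h.adj_old a b).2 hb⟩
  · rcases hH i with hi | ⟨j, hj⟩
    · exact ⟨φ v, (h.adj_mix' v i).2 ⟨rfl, hi⟩⟩
    · exact ⟨p j, (h.adj_new i j).2 hj⟩

theorem isTree (hT : T.IsTree) : G.IsTree := by
  classical
  have : Nonempty V := ⟨v⟩
  obtain ⟨g, hg⟩ : ∃ g : W → V, (∀ a, g (φ a) = a) ∧ ∀ i, g (p i) = v := by
    let e := Equiv.ofBijective _ h.bij
    refine ⟨fun w => Sum.elim id (fun _ => v) (e.symm w), fun a => ?_, fun i => ?_⟩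
    · have : e.symm (φ a) = Sum.inl a := e.symm_apply_eq.2 rfl
      simp [this]
    · have : e.symm (p i) = Sum.inr i := e.symm_apply_eq.2 rfl
      simp [this]
  have hadj : ∀ x y, T.Adj x y → G.Reachable (g x) (g y) := by
    intro x y hxy
    rcases h.cover x with ⟨a, rfl⟩ | ⟨i, rfl⟩ <;> rcases h.cover y with ⟨b, rfl⟩ | ⟨j, rfl⟩
    · rw [hg.1, hg.1]
      exact ((h.adj_old a b).1 hxy).reachable
    · rw [hg.1, hg.2, ((h.adj_mix a j).1 hxy).1]
    · rw [hg.1, hg.2, ((h.adj_mix' b i).1 hxy).1]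
    · rw [hg.2, hg.2]
  have hwalk : ∀ x y, T.Walk x y → G.Reachable (g x) (g y) := by
    intro x y q
    induction q with
    | nil => rfl
    | cons hq _ ih => exact (hadj _ _ hq).trans ih
  refine ⟨⟨fun a b => ?_⟩, ?_⟩
  · obtain ⟨q⟩ := hT.connected (φ a) (φ b)
    simpa [hg.1] using hwalk _ _ q
  · exact hT.isAcyclic.comap ⟨φ, fun {a b} hab => (h.adj_old a b).2 hab⟩ h.inj_old

end Basic

section Domination

/-- A minimum solution of the old graph together with a choice of new vertices and edges. -/
theorem extend (h : Att H r G v T φ p) [Finite V] [Finite W] {C : Set V} {F : Set (Sym2 V)}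
    (hd : SemiDom G ∅ C F)
    (C₀ : Finset ι) (F₀ : Set (Sym2 W)) (hsub : F₀ ⊆ T.edgeSet)
    (hdom : ∀ i, ∃ u, s(p i, u) ∈ F₀) (hcov : ∀ i j, H.Adj i j → i ∈ C₀ ∨ j ∈ C₀)
    (hind : ∀ i j, H.Adj i j → i ∈ C₀ ∨ s(p i, p j) ∈ F₀)
    (hroot : ∀ i, r i → (v ∈ C ∨ i ∈ C₀) ∧
      (s(φ v, p i) ∈ F₀ ∨ (v ∈ C ∧ i ∈ C₀))) :
    SemiDom T ∅ (φ '' C ∪ p '' C₀) (Sym2.map φ '' F ∪ F₀) ∧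
      (φ '' C ∪ p '' C₀).ncard + (Sym2.map φ '' F ∪ F₀).ncard ≤
        C.ncard + F.ncard + (C₀.card + F₀.ncard) := by
  classical
  have := h.finite_new
  have memC : ∀ a, a ∈ C → φ a ∈ φ '' C ∪ p '' (C₀ : Set ι) := fun a ha => Or.inl ⟨a, ha, rfl⟩
  have memC₀ : ∀ i, i ∈ C₀ → p i ∈ φ '' C ∪ p '' (C₀ : Set ι) := fun i hi => Or.inr ⟨i, hi, rfl⟩
  have memF : ∀ a b, s(a, b) ∈ F → s(φ a, φ b) ∈ Sym2.map φ '' F ∪ F₀ :=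
    fun a b hab => Or.inl ⟨s(a, b), hab, rfl⟩
  refine ⟨⟨?_, ?_, ?_, ?_⟩, ?_⟩
  · rintro e (⟨e, he, rfl⟩ | he)
    · induction e with
      | h a b => exact (h.adj_old a b).2 (hd.sub he)
    · exact hsub he
  · intro w _
    rcases h.cover w with ⟨a, rfl⟩ | ⟨i, rfl⟩
    · obtain ⟨b, hb⟩ := hd.dom a (by simp)
      exact ⟨φ b, memF a b hb⟩
    · obtain ⟨u, hu⟩ := hdom i
      exact ⟨u, Or.inr hu⟩
  · intro x y hxy
    rcases h.cover x with ⟨a, rfl⟩ | ⟨i, rfl⟩ <;> rcases h.cover y with ⟨b, rfl⟩ | ⟨j, rfl⟩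
    · exact (hd.cov a b ((h.adj_old a b).1 hxy)).imp (memC a) (memC b)
    · obtain ⟨rfl, hj⟩ := (h.adj_mix a j).1 hxy
      exact (hroot j hj).1.imp (memC a) (memC₀ j)
    · obtain ⟨rfl, hi⟩ := (h.adj_mix' b i).1 hxy
      exact ((hroot i hi).1.imp (memC b) (memC₀ i)).symm
    · exact (hcov i j ((h.adj_new i j).1 hxy)).imp (memC₀ i) (memC₀ j)
  · intro x y hxy
    rcases h.cover x with ⟨a, rfl⟩ | ⟨i, rfl⟩ <;> rcases h.cover y with ⟨b, rfl⟩ | ⟨j, rfl⟩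
    · exact (hd.ind a b ((h.adj_old a b).1 hxy)).imp (memC a) (memF a b)
    · obtain ⟨rfl, hj⟩ := (h.adj_mix a j).1 hxy
      exact (hroot j hj).2.symm.imp (fun hc => memC a hc.1) Or.inr
    · obtain ⟨rfl, hi⟩ := (h.adj_mix' b i).1 hxy
      refine (hroot i hi).2.symm.imp (fun hc => memC₀ i hc.2) fun hc => Or.inr ?_
      rwa [Sym2.eq_swap]
    · exact (hind i j ((h.adj_new i j).1 hxy)).imp (memC₀ i) Or.inr
  · have h1 := Set.ncard_union_le (φ '' C) (p '' (C₀ : Set ι))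
    have h2 := Set.ncard_union_le (Sym2.map φ '' F) F₀
    have h3 := Set.ncard_image_of_injective C h.inj_old
    have h4 : (p '' (C₀ : Set ι)).ncard = C₀.card := by
      rw [Set.ncard_image_of_injective _ h.inj_new, Set.ncard_coe_finset]
    have h5 := Set.ncard_image_of_injective F (Sym2.map.injective h.inj_old)
    omega

/-- Restriction of a solution to the old graph. -/
theorem restrict (h : Att H r G v T φ p) {C : Set W} {F : Set (Sym2 W)}
    (hd : SemiDom T {φ v} C F) : SemiDom G {v} (φ ⁻¹' C) (Sym2.map φ ⁻¹' F) := by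
  refine ⟨?_, ?_, ?_, ?_⟩
  · intro e he
    induction e with
    | h a b => exact (h.adj_old a b).1 (hd.sub he)
  · intro a ha
    obtain ⟨u, hu⟩ := hd.dom (φ a) fun hc => ha (h.inj_old hc)
    rcases h.cover u with ⟨b, rfl⟩ | ⟨i, rfl⟩
    · exact ⟨b, hu⟩
    · exact absurd ((h.adj_mix a i).1 (hd.sub hu)).1 ha
  · exact fun a b hab => hd.cov _ _ ((h.adj_old a b).2 hab)
  · exact fun a b hab => hd.ind _ _ ((h.adj_old a b).2 hab)

end Domination

end Att

theorem ncard_preimage_add_sum_le {α β κ : Type*} [Finite β] [Fintype κ] {f : α → β} {q : κ → β}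
    (hf : Function.Injective f) (hq : Function.Injective q) (hfq : ∀ a i, f a ≠ q i) (A : Set β)
    [DecidablePred (· ∈ A)] :
    (f ⁻¹' A).ncard + ∑ i, (if q i ∈ A then 1 else 0) ≤ A.ncard := by
  have h1 : ∑ i, (if q i ∈ A then 1 else 0) = (q ⁻¹' A).ncard := by
    rw [← Finset.card_filter, ← Set.ncard_coe_finset]
    congr 1
    ext
    simp
  rw [h1, ← Set.ncard_image_of_injective _ hf, ← Set.ncard_image_of_injective (q ⁻¹' A) hq,
    ← Set.ncard_union_eq]
  · refine Set.ncard_le_ncard ?_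
    rintro _ (⟨a, ha, rfl⟩ | ⟨a, ha, rfl⟩) <;> exact ha
  · rw [Set.disjoint_left]
    rintro _ ⟨a, -, rfl⟩ ⟨i, -, hi⟩
    exact hfq a i hi.symm

/-- The vertices adjacent to a leaf other than `v`. -/
def supportsAvoiding {V : Type u} (G : SimpleGraph V) (v : V) : Set V :=
  {x | ∃ y, y ≠ v ∧ G.Adj x y ∧ IsLeafVert G y}

section Counting

variable {V : Type u} {G : SimpleGraph V} {v : V}

theorem IsSupportVert.not_isStrongLeaf (hv : IsSupportVert G v) : ¬ IsStrongLeaf G v := by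
  rintro ⟨hl, u, hvu, a, b, hab, hua, hub, -, -⟩
  obtain ⟨z, hvz, hz⟩ := hv
  have := hl.eq hvu hvz
  subst this
  exact hab (hz.eq hua hub)

theorem leaf_count_avoiding_of_not_isStrongLeaf [Finite V] (hG : NoIsolated G)
    (hv : ¬ IsStrongLeaf G v) :
    ({x | IsLeafVert G x} \ {v}).ncard + {x | IsSupportVert G x}.ncard =
      {x | IsLeafVert G x}.ncard + (supportsAvoiding G v).ncard := by
  by_cases hl : IsLeafVert G v
  · obtain ⟨u, hu⟩ := hG v
    have hS : {x | IsSupportVert G x} = insert u (supportsAvoiding G v) := by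
      ext x
      constructor
      · rintro ⟨y, hxy, hy⟩
        by_cases hyv : y = v
        · subst hyv
          exact Or.inl (hl.eq hxy.symm hu)
        · exact Or.inr ⟨y, hyv, hxy, hy⟩
      · rintro (rfl | ⟨y, -, hxy, hy⟩)
        · exact ⟨v, hu.symm, hl⟩
        · exact ⟨y, hxy, hy⟩
    have hu' : u ∉ supportsAvoiding G v := by
      rintro ⟨y, hyv, huy, hy⟩
      exact hv ⟨hl, u, hu, v, y, hyv.symm, hu.symm, huy, hl, hy⟩
    rw [hS, Set.ncard_insert_of_notMem hu']
    have := Set.ncard_sdiff_singleton_add_one (s := {x | IsLeafVert G x}) hl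
    omega
  · have hS : {x | IsSupportVert G x} = supportsAvoiding G v := by
      ext x
      constructor
      · rintro ⟨y, hxy, hy⟩
        exact ⟨y, fun hyv => hl (hyv ▸ hy), hxy, hy⟩
      · rintro ⟨y, -, hxy, hy⟩
        exact ⟨y, hxy, hy⟩
    rw [Set.sdiff_singleton_eq_self (by exact hl), hS]

theorem leaf_count_avoiding_of_isStrongLeaf [Finite V] (hv : IsStrongLeaf G v) :
    ({x | IsLeafVert G x} \ {v}).ncard + {x | IsSupportVert G x}.ncard + 1 =
      {x | IsLeafVert G x}.ncard + (supportsAvoiding G v).ncard := by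
  obtain ⟨hl, u, hvu, a, b, hab, hua, hub, ha, hb⟩ := hv
  have hS : {x | IsSupportVert G x} = supportsAvoiding G v := by
    ext x
    constructor
    · rintro ⟨y, hxy, hy⟩
      by_cases hyv : y = v
      · subst hyv
        rw [hl.eq hxy.symm hvu]
        by_cases hay : a = y
        · exact ⟨b, fun hby => hab (hay.trans hby.symm), hub, hb⟩
        · exact ⟨a, hay, hua, ha⟩
      · exact ⟨y, hyv, hxy, hy⟩
    · rintro ⟨y, -, hxy, hy⟩
      exact ⟨y, hxy, hy⟩
  rw [hS]
  have := Set.ncard_sdiff_singleton_add_one (s := {x | IsLeafVert G x}) hl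
  omega

/-- Three times the gap between the upper bound and the domination number. -/
noncomputable def gap {V : Type u} (G : SimpleGraph V) : ℤ :=
  4 * (Nat.card V : ℤ) - {x | IsLeafVert G x}.ncard + {x | IsSupportVert G x}.ncard - 2
    - 3 * subToid G

end Counting

namespace Att

variable {V W : Type u} {ι : Type*} {H : SimpleGraph ι} {r : ι → Prop} {G : SimpleGraph V}
  {v : V} {T : SimpleGraph W} {φ : V → W} {p : ι → W} (h : Att H r G v T φ p)
include h

theorem isLeafVert_old_iff {a : V} (ha : a ≠ v) : IsLeafVert T (φ a) ↔ IsLeafVert G a := by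
  have hnew : ∀ i, ¬ T.Adj (φ a) (p i) := fun i hi => ha ((h.adj_mix a i).1 hi).1
  constructor
  · rintro ⟨w, hw, hu⟩
    rcases h.cover w with ⟨b, rfl⟩ | ⟨i, rfl⟩
    · exact ⟨b, (h.adj_old a b).1 hw, fun c hc => h.inj_old (hu _ ((h.adj_old a c).2 hc))⟩
    · exact absurd hw (hnew i)
  · rintro ⟨b, hb, hu⟩
    refine ⟨φ b, (h.adj_old a b).2 hb, fun w hw => ?_⟩
    rcases h.cover w with ⟨c, rfl⟩ | ⟨i, rfl⟩
    · rw [hu c ((h.adj_old a c).1 hw)]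
    · exact absurd hw (hnew i)

theorem not_isLeafVert_vertex (hG : NoIsolated G) (hr : ∃ i, r i) : ¬ IsLeafVert T (φ v) := by
  obtain ⟨u, hu⟩ := hG v
  obtain ⟨i, hi⟩ := hr
  exact not_isLeafVert_of ((h.adj_old v u).2 hu) ((h.adj_mix v i).2 ⟨rfl, hi⟩) (h.ne u i)

theorem isLeafVert_new_iff {i : ι} (hi : ¬ r i) : IsLeafVert T (p i) ↔ ∃! j, H.Adj i j := by
  have hold : ∀ a, ¬ T.Adj (p i) (φ a) := fun a ha => hi ((h.adj_mix' a i).1 ha).2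
  constructor
  · rintro ⟨w, hw, hu⟩
    rcases h.cover w with ⟨b, rfl⟩ | ⟨j, rfl⟩
    · exact absurd hw (hold b)
    · exact ⟨j, (h.adj_new i j).1 hw, fun c hc => h.inj_new (hu _ ((h.adj_new i c).2 hc))⟩
  · rintro ⟨j, hj, hu⟩
    refine ⟨p j, (h.adj_new i j).2 hj, fun w hw => ?_⟩
    rcases h.cover w with ⟨c, rfl⟩ | ⟨k, rfl⟩
    · exact absurd hw (hold c)
    · rw [hu k ((h.adj_new i k).1 hw)]

theorem not_isLeafVert_root {i : ι} (hi : r i) (hH : ∃ j, H.Adj i j) : ¬ IsLeafVert T (p i) := by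
  obtain ⟨j, hj⟩ := hH
  exact not_isLeafVert_of ((h.adj_mix' v i).2 ⟨rfl, hi⟩) ((h.adj_new i j).2 hj) (h.ne v j)

theorem leafSet_eq (hG : NoIsolated G) (hr : ∃ i, r i) (K : Set ι)
    (hK : ∀ i, IsLeafVert T (p i) ↔ i ∈ K) :
    {x | IsLeafVert T x} = φ '' ({x | IsLeafVert G x} \ {v}) ∪ p '' K := by
  ext w
  constructor
  · intro hw
    rcases h.cover w with ⟨a, rfl⟩ | ⟨i, rfl⟩
    · have hav : a ≠ v := by
        rintro rfl
        exact h.not_isLeafVert_vertex hG hr hw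
      exact Or.inl ⟨a, ⟨(h.isLeafVert_old_iff hav).1 hw, hav⟩, rfl⟩
    · exact Or.inr ⟨i, (hK i).1 hw, rfl⟩
  · rintro (⟨a, ⟨ha, hav⟩, rfl⟩ | ⟨i, hi, rfl⟩)
    · exact (h.isLeafVert_old_iff hav).2 ha
    · exact (hK i).2 hi

theorem supportSet_eq (hG : NoIsolated G) (hr : ∃ i, r i) (K M : Set ι)
    (hK : ∀ i, IsLeafVert T (p i) ↔ i ∈ K) (hrK : ∀ i, r i → i ∉ K)
    (hM : ∀ i, i ∈ M ↔ ∃ j ∈ K, H.Adj i j) :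
    {x | IsSupportVert T x} = φ '' supportsAvoiding G v ∪ p '' M := by
  ext w
  constructor
  · rintro ⟨y, hwy, hy⟩
    rcases h.cover y with ⟨a, rfl⟩ | ⟨i, rfl⟩
    · have hav : a ≠ v := by
        rintro rfl
        exact h.not_isLeafVert_vertex hG hr hy
      rcases h.cover w with ⟨b, rfl⟩ | ⟨j, rfl⟩
      · exact Or.inl ⟨b, ⟨a, hav, (h.adj_old b a).1 hwy, (h.isLeafVert_old_iff hav).1 hy⟩, rfl⟩
      · exact absurd ((h.adj_mix' a j).1 hwy).1 hav
    · rcases h.cover w with ⟨b, rfl⟩ | ⟨j, rfl⟩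
      · exact absurd ((hK i).1 hy) (hrK i ((h.adj_mix b i).1 hwy).2)
      · exact Or.inr ⟨j, (hM j).2 ⟨i, (hK i).1 hy, (h.adj_new j i).1 hwy⟩, rfl⟩
  · rintro (⟨b, ⟨a, hav, hba, ha⟩, rfl⟩ | ⟨j, hj, rfl⟩)
    · exact ⟨φ a, (h.adj_old b a).2 hba, (h.isLeafVert_old_iff hav).2 ha⟩
    · obtain ⟨i, hi, hji⟩ := (hM j).1 hj
      exact ⟨p i, (h.adj_new j i).2 hji, (hK i).2 hi⟩

theorem ncard_union (A : Set V) (K : Set ι) [Finite V] [Finite ι] :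
    (φ '' A ∪ p '' K).ncard = A.ncard + K.ncard := by
  rw [Set.ncard_union_eq, Set.ncard_image_of_injective _ h.inj_old,
    Set.ncard_image_of_injective _ h.inj_new]
  rw [Set.disjoint_left]
  rintro _ ⟨a, -, rfl⟩ ⟨i, -, hi⟩
  exact h.ne a i hi.symm

/-- Change of the gap when the new part has equally many leaves and support vertices. -/
theorem gap_eq [Finite V] [Finite ι] (hG : NoIsolated G) (hr : ∃ i, r i) (K M : Set ι)
    (hK : ∀ i, IsLeafVert T (p i) ↔ i ∈ K) (hrK : ∀ i, r i → i ∉ K)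
    (hM : ∀ i, i ∈ M ↔ ∃ j ∈ K, H.Adj i j) (hKM : K.ncard = M.ncard) :
    (¬ IsStrongLeaf G v →
      gap T = gap G + 4 * Nat.card ι - 3 * ((subToid T : ℤ) - subToid G)) ∧
    (IsStrongLeaf G v →
      gap T = gap G + 4 * Nat.card ι + 1 - 3 * ((subToid T : ℤ) - subToid G)) := by
  have h1 := h.leafSet_eq hG hr K hK
  have h2 := h.supportSet_eq hG hr K M hK hrK hM
  constructor
  · intro hv
    have := leaf_count_avoiding_of_not_isStrongLeaf hG hv
    rw [gap, gap, h1, h2, h.ncard_union, h.ncard_union, h.card]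
    push_cast
    omega
  · intro hv
    have := leaf_count_avoiding_of_isStrongLeaf hv
    rw [gap, gap, h1, h2, h.ncard_union, h.ncard_union, h.card]
    push_cast
    omega

/-- Strong leaves remain strong leaves unless something is attached to them. -/
theorem isStrongLeaf_old (hv : ¬ IsStrongLeaf G v) {a : V} (ha : IsStrongLeaf G a) :
    IsStrongLeaf T (φ a) := by
  have hne : ∀ b, IsStrongLeaf G b → b ≠ v := by
    rintro b hb rfl
    exact hv hb
  obtain ⟨hl, u, hau, x, y, hxy, hux, huy, hx, hy⟩ := ha
  have hu : IsStrongSupportVert G u := ⟨x, y, hxy, hux, huy, hx, hy⟩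
  exact ⟨(h.isLeafVert_old_iff (hne a ⟨hl, u, hau, hu⟩)).2 hl, φ u, (h.adj_old a u).2 hau,
    φ x, φ y, fun hc => hxy (h.inj_old hc), (h.adj_old u x).2 hux, (h.adj_old u y).2 huy,
    (h.isLeafVert_old_iff (hne x ⟨hx, u, hux.symm, hu⟩)).2 hx,
    (h.isLeafVert_old_iff (hne y ⟨hy, u, huy.symm, hu⟩)).2 hy⟩

end Att

/-- `T` arises from `G` by joining the vertex `v` to the vertex `j` of a new path on `k`
vertices. -/
abbrev AttPath {V W : Type u} (k : ℕ) (j : Fin k) (G : SimpleGraph V) (v : V) (T : SimpleGraph W)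
    (φ : V → W) (p : Fin k → W) : Prop :=
  Att (pathGraph k) (fun i => i = j) G v T φ p

/-- Every vertex that is not a strong leaf lies in a minimum solution. -/
def Flexible {V : Type u} (G : SimpleGraph V) : Prop :=
  ∀ x, ¬ IsStrongLeaf G x → ∃ C F, SemiDom G ∅ C F ∧ C.ncard + F.ncard ≤ subToid G ∧ x ∈ C

/-- The path `y z` is a pendant path attached to `w`. -/
def PendantAt {V : Type u} (G : SimpleGraph V) (w y z : V) : Prop :=
  IsLeafVert G z ∧ G.Adj y z ∧ G.Adj y w ∧ w ≠ z ∧ ∀ x, G.Adj y x → x = w ∨ x = z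

/-- Vertices carrying a pendant path on two vertices have degree at most two and are not support
vertices. -/
def PendantCond {V : Type u} (G : SimpleGraph V) : Prop :=
  ∀ w y z, PendantAt G w y z →
    ¬ IsSupportVert G w ∧ ∀ a b, G.Adj w a → G.Adj w b → a ≠ y → b ≠ y → a = b

namespace AttPath

variable {V W : Type u} {G : SimpleGraph V} {v : V} {T : SimpleGraph W} {φ : V → W}

theorem noIsolated_of {k : ℕ} {j : Fin k} {p : Fin k → W} (h : AttPath k j G v T φ p)
    (hG : NoIsolated G) : NoIsolated T := by
  refine h.noIsolated hG fun i => ?_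
  by_cases hk : k = 1
  · subst hk
    exact Or.inl (Subsingleton.elim _ _)
  · right
    by_cases hi : i.val + 1 < k
    · exact ⟨⟨i + 1, hi⟩, by simp [pathGraph_adj]⟩
    · have := i.2
      exact ⟨⟨i - 1, by omega⟩, by simp only [pathGraph_adj]; omega⟩

section One

variable {p : Fin 1 → W} (h : AttPath 1 0 G v T φ p)
include h

theorem isLeafVert_one : IsLeafVert T (p 0) := by
  refine isLeafVert_of ((h.adj_mix' v 0).2 ⟨rfl, rfl⟩) fun w hw => ?_
  rcases h.cover w with ⟨a, rfl⟩ | ⟨i, rfl⟩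
  · rw [((h.adj_mix' a 0).1 hw).1]
  · rw [Subsingleton.elim i 0] at hw
    exact absurd rfl hw.ne

theorem extend_one [Finite V] [Finite W] {C : Set V} {F : Set (Sym2 V)} (hd : SemiDom G ∅ C F)
    (hv : v ∈ C) : ∃ C' F', SemiDom T ∅ C' F' ∧ C'.ncard + F'.ncard ≤ C.ncard + F.ncard + 1 ∧
      ∀ a ∈ C, φ a ∈ C' := by
  have := h.extend hd ∅ {s(φ v, p 0)} (by simp [h.adj_mix])
    (fun i => ⟨φ v, by rw [Subsingleton.elim i 0]; simp [Sym2.eq_swap]⟩)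
    (by simp [pathGraph_adj]) (by simp [pathGraph_adj])
    (fun i _ => ⟨Or.inl hv, Or.inl (by rw [Subsingleton.elim i 0]; simp)⟩)
  exact ⟨_, _, this.1, by simpa using this.2, fun a ha => Or.inl ⟨a, ha, rfl⟩⟩

theorem subToid_one_le [Finite V] [Finite W] (hG : NoIsolated G) (hv : IsSupportVert G v) :
    subToid T ≤ subToid G + 1 := by
  obtain ⟨C, F, hd, hc, hvC⟩ := exists_subToid_mem_support hG hv
  obtain ⟨C', F', hd', hc', -⟩ := h.extend_one hd hvC
  have := subToid_le hd'
  omega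

theorem le_subToid_one [Finite V] [Finite W] (hG : NoIsolated G) (hv : IsSupportVert G v) :
    subToid G + 1 ≤ subToid T := by
  classical
  obtain ⟨C, F, hd, hc⟩ := exists_subToid (h.noIsolated_of hG)
  have hd' := h.restrict (hd.mono (Set.empty_subset _))
  have h1 := hd'.repair hG (Or.inl hv)
  have h2 : s(φ v, p 0) ∈ F :=
    hd.leaf_edge h.isLeafVert_one (by simp) ((h.adj_mix v 0).2 ⟨rfl, rfl⟩)
  have h3 := ncard_preimage_add_sum_le (f := φ) (q := p) h.inj_old h.inj_new h.ne C
  have h4 := ncard_preimage_add_sum_le (f := Sym2.map φ) (q := fun _ : Fin 1 => s(φ v, p 0))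
    (Sym2.map.injective h.inj_old) (fun _ _ _ => Subsingleton.elim _ _) (by
      intro e i he
      have : p 0 ∈ Sym2.map φ e := by rw [he]; simp
      obtain ⟨a, -, ha⟩ := Sym2.mem_map.1 this
      exact h.ne a 0 ha) F
  simp only [h2, if_true, Finset.sum_const, Finset.card_univ, Fintype.card_fin, smul_eq_mul,
    mul_one] at h4
  omega

theorem gap_one [Finite V] [Finite W] (hG : NoIsolated G) (hv : IsSupportVert G v) :
    gap T = gap G + 3 - 3 * ((subToid T : ℤ) - subToid G) := by
  have hr : ∃ i : Fin 1, i = 0 := ⟨0, rfl⟩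
  have hK : ∀ i, IsLeafVert T (p i) ↔ i ∈ (Set.univ : Set (Fin 1)) := fun i => by
    rw [Subsingleton.elim i 0]
    simp [h.isLeafVert_one]
  have h1 := h.leafSet_eq hG hr _ hK
  have h2 : {x | IsSupportVert T x} = φ '' supportsAvoiding G v := by
    ext w
    constructor
    · rintro ⟨y, hwy, hy⟩
      rcases h.cover y with ⟨a, rfl⟩ | ⟨i, rfl⟩
      · have hav : a ≠ v := by
          rintro rfl
          exact h.not_isLeafVert_vertex hG hr hy
        rcases h.cover w with ⟨b, rfl⟩ | ⟨j, rfl⟩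
        · exact ⟨b, ⟨a, hav, (h.adj_old b a).1 hwy, (h.isLeafVert_old_iff hav).1 hy⟩, rfl⟩
        · exact absurd ((h.adj_mix' a j).1 hwy).1 hav
      · rcases h.cover w with ⟨b, rfl⟩ | ⟨j, rfl⟩
        · obtain ⟨z, hvz, hz⟩ := hv
          refine ⟨b, ?_, rfl⟩
          rw [((h.adj_mix b i).1 hwy).1]
          exact ⟨z, hvz.ne', hvz, hz⟩
        · rw [Subsingleton.elim i j] at hwy
          exact absurd rfl hwy.ne
    · rintro ⟨b, ⟨a, hav, hba, ha⟩, rfl⟩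
      exact ⟨φ a, (h.adj_old b a).2 hba, (h.isLeafVert_old_iff hav).2 ha⟩
  have h3 := leaf_count_avoiding_of_not_isStrongLeaf hG hv.not_isStrongLeaf
  rw [gap, gap, h1, h2, h.ncard_union, h.card, Set.ncard_image_of_injective _ h.inj_old]
  simp only [Set.ncard_univ, Nat.card_eq_fintype_card, Fintype.card_fin]
  push_cast
  omega

theorem flexible_one [Finite V] [Finite W] (hG : NoIsolated G) (hv : IsSupportVert G v)
    (hf : Flexible G) : Flexible T := by
  intro x hx
  obtain ⟨z, hvz, hz⟩ := hv
  have hv : IsSupportVert G v := ⟨z, hvz, hz⟩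
  have hstrong : IsStrongSupportVert T (φ v) :=
    ⟨p 0, φ z, (h.ne z 0).symm, (h.adj_mix v 0).2 ⟨rfl, rfl⟩, (h.adj_old v z).2 hvz,
      h.isLeafVert_one, (h.isLeafVert_old_iff hvz.ne').2 hz⟩
  rcases h.cover x with ⟨a, rfl⟩ | ⟨i, rfl⟩
  · obtain ⟨C, F, hd, hc, haC⟩ := hf a fun ha =>
      hx (h.isStrongLeaf_old hv.not_isStrongLeaf ha)
    have haz : a ≠ z := by
      rintro rfl
      exact hx ⟨(h.isLeafVert_old_iff hvz.ne').2 hz, φ v, (h.adj_old a v).2 hvz.symm, hstrong⟩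
    obtain ⟨C₁, hd₁, hc₁, haC₁, hvC₁⟩ : ∃ C₁, SemiDom G ∅ C₁ F ∧
        C₁.ncard + F.ncard ≤ subToid G ∧ a ∈ C₁ ∧ v ∈ C₁ := by
      by_cases hvC : v ∈ C
      · exact ⟨C, hd, hc, haC, hvC⟩
      · obtain ⟨h1, h2⟩ := hd.swap_leaf hz hvz hvC
        exact ⟨_, h1, h2.trans hc, Or.inr ⟨haC, haz⟩, Or.inl rfl⟩
    obtain ⟨C', F', hd', hc', hsub⟩ := h.extend_one hd₁ hvC₁
    have := h.le_subToid_one hG hv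
    exact ⟨C', F', hd', by omega, hsub a haC₁⟩
  · rw [Subsingleton.elim i 0] at hx
    exact absurd ⟨h.isLeafVert_one, φ v, (h.adj_mix' v 0).2 ⟨rfl, rfl⟩, hstrong⟩ hx

theorem pendantCond_one (hG : NoIsolated G) (hv : IsSupportVert G v)
    (hp : PendantCond G) : PendantCond T := by
  have hr : ∃ i : Fin 1, i = 0 := ⟨0, rfl⟩
  have hold : ∀ a, IsLeafVert T (φ a) → a ≠ v ∧ IsLeafVert G a := fun a ha => by
    have hav : a ≠ v := by
      rintro rfl
      exact h.not_isLeafVert_vertex hG hr ha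
    exact ⟨hav, (h.isLeafVert_old_iff hav).1 ha⟩
  have hadj : ∀ x i, T.Adj x (p i) → x = φ v := by
    intro x i hx
    rcases h.cover x with ⟨a, rfl⟩ | ⟨j, rfl⟩
    · rw [((h.adj_mix a i).1 hx).1]
    · rw [Subsingleton.elim i j] at hx
      exact absurd rfl hx.ne
  rintro w y z ⟨hz, hyz, hyw, hwz, hy⟩
  rcases h.cover y with ⟨y, rfl⟩ | ⟨i, rfl⟩
  swap
  · exact absurd ((hadj z i hyz.symm).trans (hadj w i hyw.symm).symm).symm hwz
  obtain ⟨z', hvz', hz'⟩ := id hv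
  by_cases hyv : y = v
  · -- the pendant path ends at the attachment vertex
    subst hyv
    have hp0 := hy (p 0) ((h.adj_mix y 0).2 ⟨rfl, rfl⟩)
    have hzp := hy (φ z') ((h.adj_old y z').2 hvz')
    have hz'T := (h.isLeafVert_old_iff hvz'.ne').2 hz'
    have hwl : IsLeafVert T w := by
      rcases hp0 with rfl | rfl
      · exact h.isLeafVert_one
      · rcases hzp with rfl | hzp
        · exact hz'T
        · exact absurd hzp (h.ne z' 0)
    refine ⟨?_, fun a b ha hb _ _ => hwl.eq ha hb⟩
    rintro ⟨x, hwx, hx⟩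
    have := hwl.eq hyw.symm hwx
    subst this
    exact h.not_isLeafVert_vertex hG hr hx
  have hzo : ∃ z₁, φ z₁ = z := by
    rcases h.cover z with hz | ⟨i, rfl⟩
    · exact hz
    · exact absurd (h.inj_old (hadj _ i hyz)) hyv
  have hwo : ∃ w₁, φ w₁ = w := by
    rcases h.cover w with hw | ⟨i, rfl⟩
    · exact hw
    · exact absurd (h.inj_old (hadj _ i hyw)) hyv
  obtain ⟨z, rfl⟩ := hzo
  obtain ⟨w, rfl⟩ := hwo
  obtain ⟨h1, h2⟩ := hp w y z ⟨(hold z hz).2, (h.adj_old y z).1 hyz, (h.adj_old y w).1 hyw,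
    fun hc => hwz (by rw [hc]), fun x hx =>
      (hy (φ x) ((h.adj_old y x).2 hx)).imp (fun hc => h.inj_old hc) (fun hc => h.inj_old hc)⟩
  have hwv : w ≠ v := by
    rintro rfl
    exact h1 hv
  have hnew : ∀ x, T.Adj (φ w) x → ∃ a, φ a = x := fun x hx => by
    rcases h.cover x with hx' | ⟨i, rfl⟩
    · exact hx'
    · exact absurd (h.inj_old (hadj _ i hx)) hwv
  refine ⟨?_, ?_⟩
  · rintro ⟨x, hwx, hx⟩
    obtain ⟨x, rfl⟩ := hnew x hwx
    exact h1 ⟨x, (h.adj_old w x).1 hwx, (hold x hx).2⟩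
  · intro a b ha hb hay hby
    obtain ⟨a, rfl⟩ := hnew a ha
    obtain ⟨b, rfl⟩ := hnew b hb
    rw [h2 a b ((h.adj_old w a).1 ha) ((h.adj_old w b).1 hb) (fun hc => hay (by rw [hc]))
      (fun hc => hby (by rw [hc]))]

end One

end AttPath

theorem ncard_pair_le {α : Type*} (a b : α) : ({a, b} : Set α).ncard ≤ 2 :=
  (Set.ncard_insert_le _ _).trans (by simp)

theorem ncard_quadruple_le {α : Type*} (a b c d : α) : ({a, b, c, d} : Set α).ncard ≤ 4 := by
  have h1 := Set.ncard_insert_le a {b, c, d}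
  have h2 := Set.ncard_insert_le b {c, d}
  have h3 := ncard_pair_le c d
  omega

namespace AttPath

variable {V W : Type u} {G : SimpleGraph V} {v : V} {T : SimpleGraph W} {φ : V → W}

section Three

variable {p : Fin 3 → W} (h : AttPath 3 0 G v T φ p)
include h

theorem adj_vertex_zero : T.Adj (φ v) (p 0) := (h.adj_mix v 0).2 ⟨rfl, rfl⟩

theorem adj_zero_one : T.Adj (p 0) (p 1) := (h.adj_new 0 1).2 (by simp [pathGraph_adj])

theorem adj_one_two : T.Adj (p 1) (p 2) := (h.adj_new 1 2).2 (by simp [pathGraph_adj])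

theorem adj_zero {w : W} (hw : T.Adj (p 0) w) : w = φ v ∨ w = p 1 := by
  rcases h.cover w with ⟨a, rfl⟩ | ⟨i, rfl⟩
  · exact Or.inl (by rw [((h.adj_mix' a 0).1 hw).1])
  · rw [h.adj_new, pathGraph_adj] at hw
    fin_cases i <;> simp at hw ⊢

theorem adj_one {w : W} (hw : T.Adj (p 1) w) : w = p 0 ∨ w = p 2 := by
  rcases h.cover w with ⟨a, rfl⟩ | ⟨i, rfl⟩
  · exact absurd ((h.adj_mix' a 1).1 hw).2 (by simp)
  · rw [h.adj_new, pathGraph_adj] at hw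
    fin_cases i <;> simp at hw ⊢

theorem adj_two {w : W} (hw : T.Adj (p 2) w) : w = p 1 := by
  rcases h.cover w with ⟨a, rfl⟩ | ⟨i, rfl⟩
  · exact absurd ((h.adj_mix' a 2).1 hw).2 (by simp)
  · rw [h.adj_new, pathGraph_adj] at hw
    fin_cases i <;> simp at hw ⊢

theorem isLeafVert_two : IsLeafVert T (p 2) := isLeafVert_of h.adj_one_two.symm fun _ => h.adj_two

theorem not_isLeafVert_zero : ¬ IsLeafVert T (p 0) :=
  not_isLeafVert_of h.adj_vertex_zero.symm h.adj_zero_one (h.ne v 1)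

theorem not_isLeafVert_one : ¬ IsLeafVert T (p 1) :=
  not_isLeafVert_of h.adj_zero_one.symm h.adj_one_two fun hc => by
    simpa using h.inj_new hc

theorem isLeafVert_three_iff (i : Fin 3) : IsLeafVert T (p i) ↔ i ∈ ({2} : Set (Fin 3)) := by
  have h0 := h.not_isLeafVert_zero
  have h1 := h.not_isLeafVert_one
  have h2 := h.isLeafVert_two
  fin_cases i <;> simp [h0, h1, h2]

theorem gap_three [Finite V] (hG : NoIsolated G) :
    (¬ IsStrongLeaf G v → gap T = gap G + 12 - 3 * ((subToid T : ℤ) - subToid G)) ∧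
    (IsStrongLeaf G v → gap T = gap G + 13 - 3 * ((subToid T : ℤ) - subToid G)) := by
  have := h.gap_eq hG ⟨0, rfl⟩ {2} {1} h.isLeafVert_three_iff (by simp) (fun i => by
    simp only [pathGraph_adj]
    fin_cases i <;> simp) (by simp)
  simp only [Nat.card_eq_fintype_card, Fintype.card_fin] at this
  refine ⟨fun hv => ?_, fun hv => ?_⟩
  · have := this.1 hv
    omega
  · have := this.2 hv
    omega

theorem extend_three [Finite V] [Finite W] {C : Set V} {F : Set (Sym2 V)}
    (hd : SemiDom G ∅ C F) :
    ∃ C' F', SemiDom T ∅ C' F' ∧ C'.ncard + F'.ncard ≤ C.ncard + F.ncard + 4 ∧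
      (∀ a ∈ C, φ a ∈ C') ∧ p 0 ∈ C' ∧ p 1 ∈ C' := by
  classical
  have key : ∀ a b : W, (({s(a, b), s(p 1, p 2)} : Set (Sym2 W))).ncard ≤ 2 := fun a b =>
    ncard_pair_le _ _
  have h01 := h.adj_zero_one
  have h12 := h.adj_one_two
  have hv0 := h.adj_vertex_zero
  by_cases hv : v ∈ C
  · have := h.extend hd {0, 1} {s(p 0, p 1), s(p 1, p 2)}
      (by rintro e (rfl | rfl) <;> assumption)
      (fun i => by
        fin_cases i
        · exact ⟨p 1, by simp⟩
        · exact ⟨p 2, by simp⟩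
        · exact ⟨p 1, by simp [Sym2.eq_swap]⟩)
      (by simp only [pathGraph_adj]; decide)
      (fun i j hij => by
        rw [pathGraph_adj] at hij
        fin_cases i <;> fin_cases j <;> simp at hij ⊢)
      (fun i hi => by subst hi; simp [hv])
    refine ⟨_, _, this.1, this.2.trans ?_, fun a ha => Or.inl ⟨a, ha, rfl⟩, ?_, ?_⟩
    · have := key (p 0) (p 1)
      simp
      omega
    · simp
    · simp
  · have := h.extend hd {0, 1} {s(φ v, p 0), s(p 1, p 2)}
      (by rintro e (rfl | rfl) <;> assumption)
      (fun i => by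
        fin_cases i
        · exact ⟨φ v, by simp [Sym2.eq_swap]⟩
        · exact ⟨p 2, by simp⟩
        · exact ⟨p 1, by simp [Sym2.eq_swap]⟩)
      (by simp only [pathGraph_adj]; decide)
      (fun i j hij => by
        rw [pathGraph_adj] at hij
        fin_cases i <;> fin_cases j <;> simp at hij ⊢)
      (fun i hi => by subst hi; simp)
    refine ⟨_, _, this.1, this.2.trans ?_, fun a ha => Or.inl ⟨a, ha, rfl⟩, ?_, ?_⟩
    · have := key (φ v) (p 0)
      simp
      omega
    · simp
    · simp

theorem extend_three_end [Finite V] [Finite W] {C : Set V} {F : Set (Sym2 V)}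
    (hd : SemiDom G ∅ C F) (hv : v ∈ C) :
    ∃ C' F', SemiDom T ∅ C' F' ∧ C'.ncard + F'.ncard ≤ C.ncard + F.ncard + 4 ∧ p 2 ∈ C' := by
  classical
  have key : (({s(p 0, p 1), s(p 1, p 2)} : Set (Sym2 W))).ncard ≤ 2 := ncard_pair_le _ _
  have h01 := h.adj_zero_one
  have h12 := h.adj_one_two
  have := h.extend hd {0, 2} {s(p 0, p 1), s(p 1, p 2)}
    (by rintro e (rfl | rfl) <;> assumption)
    (fun i => by
      fin_cases i
      · exact ⟨p 1, by simp⟩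
      · exact ⟨p 2, by simp⟩
      · exact ⟨p 1, by simp [Sym2.eq_swap]⟩)
    (by simp only [pathGraph_adj]; decide)
    (fun i j hij => by
      rw [pathGraph_adj] at hij
      fin_cases i <;> fin_cases j <;> simp at hij ⊢)
    (fun i hi => by subst hi; simp [hv])
  refine ⟨_, _, this.1, this.2.trans ?_, ?_⟩
  · simp
    omega
  · simp

theorem subToid_three_le [Finite V] [Finite W] (hG : NoIsolated G) :
    subToid T ≤ subToid G + 4 := by
  obtain ⟨C, F, hd, hc⟩ := exists_subToid hG
  obtain ⟨C', F', hd', hc', -⟩ := h.extend_three hd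
  have := subToid_le hd'
  omega

theorem gap_le_three [Finite V] [Finite W] (hG : NoIsolated G) :
    gap G ≤ gap T ∧ (IsStrongLeaf G v → gap G < gap T) := by
  have h1 := h.subToid_three_le hG
  have h2 := h.gap_three hG
  by_cases hv : IsStrongLeaf G v
  · have := h2.2 hv
    exact ⟨by omega, fun _ => by omega⟩
  · have := h2.1 hv
    exact ⟨by omega, fun hv' => absurd hv' hv⟩

theorem restrict_three [Finite W] {C : Set W} {F : Set (Sym2 W)} (hd : SemiDom T {φ v} C F) :
    (φ ⁻¹' C).ncard + (Sym2.map φ ⁻¹' F).ncard + 4 ≤ C.ncard + F.ncard := by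
  classical
  have h3 := ncard_preimage_add_sum_le (f := φ) (q := p) h.inj_old h.inj_new h.ne C
  have hne : ∀ i, p i ≠ φ v := fun i => (h.ne v i).symm
  have hne' : ∀ i j, p i = p j ↔ i = j := fun i j => h.inj_new.eq_iff
  have h4 := ncard_preimage_add_sum_le (f := Sym2.map φ)
    (q := ![s(φ v, p 0), s(p 0, p 1), s(p 1, p 2)])
    (Sym2.map.injective h.inj_old) (by
      intro i j hij
      fin_cases i <;> fin_cases j <;>
        simp [hne, hne', (hne _).symm] at hij ⊢) (by
      intro e i he
      obtain ⟨k, hk⟩ : ∃ k, p k ∈ Sym2.map φ e := by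
        rw [he]
        fin_cases i
        · exact ⟨0, by simp⟩
        · exact ⟨0, by simp⟩
        · exact ⟨1, by simp⟩
      obtain ⟨a, -, ha⟩ := Sym2.mem_map.1 hk
      exact h.ne a k ha) F
  have f2 : s(p 1, p 2) ∈ F := hd.leaf_edge h.isLeafVert_two (hne 2) h.adj_one_two
  have d0 : s(φ v, p 0) ∈ F ∨ s(p 0, p 1) ∈ F := by
    obtain ⟨u, hu⟩ := hd.dom (p 0) (hne 0)
    rcases h.adj_zero (hd.adj hu) with rfl | rfl
    · exact Or.inl (by rwa [Sym2.eq_swap])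
    · exact Or.inr hu
  have c1 := hd.cov _ _ h.adj_one_two
  have c2 := hd.cov _ _ h.adj_zero_one
  have i1 := hd.ind _ _ h.adj_zero_one
  have i2 := hd.ind _ _ h.adj_zero_one.symm
  have i3 := hd.ind _ _ h.adj_vertex_zero.symm
  rw [Sym2.eq_swap] at i2 i3
  simp only [Fin.sum_univ_three] at h3 h4
  simp only [Matrix.cons_val] at h4
  simp only [f2, if_true] at h4
  by_cases a : p 0 ∈ C <;> by_cases b : p 1 ∈ C <;> by_cases c : p 2 ∈ C <;>
    by_cases f0 : s(φ v, p 0) ∈ F <;> by_cases f1 : s(p 0, p 1) ∈ F <;>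
    simp only [a, b, c, f0, f1, if_true, if_false, or_self, or_true, or_false] at * <;> omega

theorem not_isStrongLeaf_vertex_three (hG : NoIsolated G) : ¬ IsStrongLeaf T (φ v) :=
  fun hc => h.not_isLeafVert_vertex hG ⟨0, rfl⟩ hc.1

end Three

/-- With the attachment vertex contained in some minimum solution, attaching a pendant path on two
vertices increases the gap. -/
theorem gap_lt_two [Finite V] [Finite W] {p : Fin 2 → W} (h : AttPath 2 0 G v T φ p)
    (hG : NoIsolated G)
    (hv : ∃ C F, SemiDom G ∅ C F ∧ C.ncard + F.ncard ≤ subToid G ∧ v ∈ C)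
    (hs : ¬ IsStrongLeaf G v) : gap G < gap T := by
  classical
  have h01 : T.Adj (p 0) (p 1) := (h.adj_new 0 1).2 (by simp [pathGraph_adj])
  have hl : ∀ i, IsLeafVert T (p i) ↔ i ∈ ({1} : Set (Fin 2)) := fun i => by
    fin_cases i
    · simpa using h.not_isLeafVert_root rfl ⟨1, by simp [pathGraph_adj]⟩
    · have := h.isLeafVert_new_iff (i := 1) (by simp)
      simp only [Fin.mk_one, this, Set.mem_singleton_iff, iff_true]
      exact ⟨0, by simp [pathGraph_adj], fun j hj => by
        simp only [pathGraph_adj] at hj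
        fin_cases j <;> simp at hj ⊢⟩
  have h1 := (h.gap_eq hG ⟨0, rfl⟩ {1} {0} hl (by simp) (fun i => by
    simp only [pathGraph_adj]
    fin_cases i <;> simp) (by simp)).1 hs
  obtain ⟨C, F, hd, hc, hvC⟩ := hv
  have := h.extend hd {0} {s(p 0, p 1)} (by rintro e rfl; exact h01)
    (fun i => by
      fin_cases i
      · exact ⟨p 1, by simp⟩
      · exact ⟨p 0, by simp [Sym2.eq_swap]⟩)
    (by simp only [pathGraph_adj]; decide)
    (fun i j hij => by
      rw [pathGraph_adj] at hij
      fin_cases i <;> fin_cases j <;> simp at hij ⊢)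
    (fun i hi => by subst hi; simp [hvC])
  have h2 := subToid_le this.1
  have h3 := this.2
  simp only [Finset.card_singleton, Set.ncard_singleton] at h3
  simp only [Nat.card_eq_fintype_card, Fintype.card_fin] at h1
  omega

section Six

variable {p : Fin 6 → W} (h : AttPath 6 2 G v T φ p)
include h

theorem gap_six [Finite V] (hG : NoIsolated G) :
    (¬ IsStrongLeaf G v → gap T = gap G + 24 - 3 * ((subToid T : ℤ) - subToid G)) ∧
    (IsStrongLeaf G v → gap T = gap G + 25 - 3 * ((subToid T : ℤ) - subToid G)) := by
  have hl : ∀ i, IsLeafVert T (p i) ↔ i ∈ ({0, 5} : Set (Fin 6)) := fun i => by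
    by_cases hi : i = 2
    · subst hi
      simpa using h.not_isLeafVert_root rfl ⟨3, by simp [pathGraph_adj]⟩
    · rw [h.isLeafVert_new_iff hi]
      simp only [pathGraph_adj, Set.mem_insert_iff, Set.mem_singleton_iff]
      revert i
      unfold ExistsUnique
      decide
  have := h.gap_eq hG ⟨2, rfl⟩ {0, 5} {1, 4} hl (by simp) (fun i => by
    simp only [pathGraph_adj]
    fin_cases i <;> simp) (by
      rw [Set.ncard_pair (by decide), Set.ncard_pair (by decide)])
  simp only [Nat.card_eq_fintype_card, Fintype.card_fin] at this
  refine ⟨fun hv => ?_, fun hv => ?_⟩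
  · have := this.1 hv
    omega
  · have := this.2 hv
    omega

/-- With the attachment vertex contained in some minimum solution, attaching a path on six
vertices through its third vertex increases the gap. -/
theorem gap_lt_six [Finite V] [Finite W] (hG : NoIsolated G)
    (hv : ∃ C F, SemiDom G ∅ C F ∧ C.ncard + F.ncard ≤ subToid G ∧ v ∈ C)
    (hs : ¬ IsStrongLeaf G v) : gap G < gap T := by
  classical
  have hadj : ∀ i j : Fin 6, (pathGraph 6).Adj i j → T.Adj (p i) (p j) := fun i j =>
    (h.adj_new i j).2
  have h1 := (h.gap_six hG).1 hs
  obtain ⟨C, F, hd, hc, hvC⟩ := hv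
  have := h.extend hd {1, 2, 4} {s(p 0, p 1), s(p 2, p 3), s(p 3, p 4), s(p 4, p 5)}
    (by
      rintro e (rfl | rfl | rfl | rfl) <;> exact hadj _ _ (by simp [pathGraph_adj]))
    (fun i => by
      fin_cases i
      · exact ⟨p 1, by simp⟩
      · exact ⟨p 0, by simp⟩
      · exact ⟨p 3, by simp⟩
      · exact ⟨p 4, by simp⟩
      · exact ⟨p 5, by simp⟩
      · exact ⟨p 4, by simp⟩)
    (by simp only [pathGraph_adj]; decide)
    (fun i j hij => by
      rw [pathGraph_adj] at hij
      fin_cases i <;> fin_cases j <;> simp at hij ⊢)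
    (fun i hi => by subst hi; simp [hvC])
  have h2 := subToid_le this.1
  have h3 := this.2
  have h4 := ncard_quadruple_le s(p 0, p 1) s(p 2, p 3) s(p 3, p 4) s(p 4, p 5)
  have h5 : ({1, 2, 4} : Finset (Fin 6)).card = 3 := by decide
  omega

theorem gap_le_six [Finite V] [Finite W] (hG : NoIsolated G) :
    gap G ≤ gap T ∧ (IsStrongLeaf G v → gap G < gap T) := by
  classical
  have hadj : ∀ i j : Fin 6, (pathGraph 6).Adj i j → T.Adj (p i) (p j) := fun i j =>
    (h.adj_new i j).2
  obtain ⟨C, F, hd, hc⟩ := exists_subToid hG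
  have := h.extend hd {1, 2, 3, 4} {s(p 0, p 1), s(φ v, p 2), s(p 3, p 4), s(p 4, p 5)}
    (by
      rintro e (rfl | rfl | rfl | rfl)
      · exact hadj _ _ (by simp [pathGraph_adj])
      · exact (h.adj_mix v 2).2 ⟨rfl, rfl⟩
      · exact hadj _ _ (by simp [pathGraph_adj])
      · exact hadj _ _ (by simp [pathGraph_adj]))
    (fun i => by
      fin_cases i
      · exact ⟨p 1, by simp⟩
      · exact ⟨p 0, by simp⟩
      · exact ⟨φ v, by simp [Sym2.eq_swap]⟩
      · exact ⟨p 4, by simp⟩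
      · exact ⟨p 5, by simp⟩
      · exact ⟨p 4, by simp⟩)
    (by simp only [pathGraph_adj]; decide)
    (fun i j hij => by
      rw [pathGraph_adj] at hij
      fin_cases i <;> fin_cases j <;> simp at hij ⊢)
    (fun i hi => by subst hi; simp)
  have h2 := subToid_le this.1
  have h3 := this.2
  have h4 := ncard_quadruple_le s(p 0, p 1) s(φ v, p 2) s(p 3, p 4) s(p 4, p 5)
  have h5 : ({1, 2, 3, 4} : Finset (Fin 6)).card = 4 := by decide
  have h1 := h.gap_six hG
  by_cases hv : IsStrongLeaf G v
  · have := h1.2 hv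
    exact ⟨by omega, fun _ => by omega⟩
  · have := h1.1 hv
    exact ⟨by omega, fun hv' => absurd hv' hv⟩

end Six

end AttPath

section Tight

variable {V W : Type u} {G : SimpleGraph V} {v : V} {T : SimpleGraph W} {φ : V → W}

/-- The properties shared by all trees of the family `𝒯`. -/
structure Tight {V : Type u} (G : SimpleGraph V) : Prop where
  finite : Finite V
  noIsolated : NoIsolated G
  gap_eq_zero : gap G = 0
  flexible : Flexible G
  pendantCond : PendantCond G

/-- A tight graph which stays tight when paths on three vertices are attached to `v`. -/
structure TightAt {V : Type u} (G : SimpleGraph V) (v : V) : Prop extends Tight G where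
  repair : ∀ C F, SemiDom G {v} C F → subToid G ≤ C.ncard + F.ncard
  not_pendantAt : ∀ y z, ¬ PendantAt G v y z
  not_isStrongLeaf : ¬ IsStrongLeaf G v

theorem Tight.tightAt_of_isSupportVert (h : Tight G) (hv : IsSupportVert G v) : TightAt G v := by
  have := h.finite
  exact { h with
    repair := fun C F hd => hd.repair h.noIsolated (Or.inl hv)
    not_pendantAt := fun y z hyz => (h.pendantCond v y z hyz).1 hv
    not_isStrongLeaf := hv.not_isStrongLeaf }

theorem Tight.tightAt_of_isWeakLeaf (h : Tight G) (hv : IsWeakLeaf G v) : TightAt G v := by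
  have := h.finite
  exact { h with
    repair := fun C F hd => hd.repair h.noIsolated (Or.inr hv.1)
    not_pendantAt := fun y z ⟨hz, hyz, hyv, hvz, _⟩ =>
      hv.2 ⟨hv.1, y, hyv.symm, v, z, hvz, hyv, hyz, hv.1, hz⟩
    not_isStrongLeaf := hv.2 }

theorem eq_or_eq_of_card_eq_two [Finite V] (hc : Nat.card V = 2) {x y : V} (hxy : x ≠ y) (w : V) :
    w = x ∨ w = y := by
  have : ({x, y} : Set V) = Set.univ :=
    Set.eq_of_subset_of_ncard_le (Set.subset_univ _) (by
      rw [Set.ncard_univ, hc, Set.ncard_pair hxy])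
  simpa using this.symm.subset (Set.mem_univ w)

theorem isLeafVert_of_card_eq_two [Finite V] (hc : Nat.card V = 2) (hG : NoIsolated G) (x : V) :
    IsLeafVert G x := by
  obtain ⟨y, hxy⟩ := hG x
  exact isLeafVert_of hxy fun b hb =>
    (eq_or_eq_of_card_eq_two hc hxy.ne b).resolve_left hb.ne'

theorem isSupportVert_of_card_eq_two [Finite V] (hc : Nat.card V = 2) (hG : NoIsolated G) (x : V) :
    IsSupportVert G x := by
  obtain ⟨y, hxy⟩ := hG x
  exact ⟨y, hxy, isLeafVert_of_card_eq_two hc hG y⟩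

theorem tight_of_card_eq_two [Finite V] (hc : Nat.card V = 2) (hG : NoIsolated G) : Tight G := by
  have sol : ∀ x y, G.Adj x y → SemiDom G ∅ {x} {s(x, y)} := by
    intro x y hxy
    have hor := eq_or_eq_of_card_eq_two hc hxy.ne
    refine ⟨by rintro e rfl; exact hxy, fun w _ => ?_, fun a b hab => ?_, fun a b hab => ?_⟩
    · rcases hor w with rfl | rfl
      · exact ⟨y, rfl⟩
      · exact ⟨x, Sym2.eq_swap⟩
    · rcases hor a with rfl | rfl
      · exact Or.inl rfl
      · exact Or.inr ((hor b).resolve_right hab.ne')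
    · rcases hor a with rfl | rfl
      · exact Or.inl rfl
      · rw [(hor b).resolve_right hab.ne']
        exact Or.inr Sym2.eq_swap
  obtain ⟨x, y, -⟩ := (Nat.card_eq_two_iff.1 hc)
  have hle : subToid G = 2 := by
    apply le_antisymm
    · obtain ⟨y, hxy⟩ := hG x
      simpa using subToid_le (sol x y hxy)
    · obtain ⟨C, F, hd, hcost⟩ := exists_subToid hG
      obtain ⟨y, hxy⟩ := hG x
      have h1 : 0 < C.ncard := by
        rw [Set.ncard_pos]
        rcases hd.cov x y hxy with h | h
        exacts [⟨_, h⟩, ⟨_, h⟩]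
      have h2 : 0 < F.ncard := by
        rw [Set.ncard_pos]
        obtain ⟨u, hu⟩ := hd.dom x (by simp)
        exact ⟨_, hu⟩
      omega
  refine ⟨inferInstance, hG, ?_, fun x _ => ?_, ?_⟩
  · have h1 : {x | IsLeafVert G x} = Set.univ :=
      Set.eq_univ_of_forall (isLeafVert_of_card_eq_two hc hG)
    have h2 : {x | IsSupportVert G x} = Set.univ :=
      Set.eq_univ_of_forall (isSupportVert_of_card_eq_two hc hG)
    rw [gap, h1, h2, hle, Set.ncard_univ, hc]
    norm_num
  · obtain ⟨y, hxy⟩ := hG x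
    exact ⟨{x}, {s(x, y)}, sol x y hxy, by simp [hle], rfl⟩
  · rintro w y z ⟨-, hyz, hyw, hwz, -⟩
    rcases eq_or_eq_of_card_eq_two hc hwz y with rfl | rfl
    · exact absurd rfl hyw.ne
    · exact absurd rfl hyz.ne

theorem AttPath.tight_one {p : Fin 1 → W} (h : AttPath 1 0 G v T φ p) (hG : Tight G)
    (hv : IsSupportVert G v) : Tight T := by
  have := hG.finite
  have := h.finite
  refine ⟨this, h.noIsolated_of hG.noIsolated, ?_, h.flexible_one hG.noIsolated hv hG.flexible,
    h.pendantCond_one hG.noIsolated hv hG.pendantCond⟩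
  have h1 := h.subToid_one_le hG.noIsolated hv
  have h2 := h.le_subToid_one hG.noIsolated hv
  have h3 := h.gap_one hG.noIsolated hv
  have := hG.gap_eq_zero
  omega

theorem AttPath.tightAt_three {p : Fin 3 → W} (h : AttPath 3 0 G v T φ p) (hG : TightAt G v) :
    TightAt T (φ v) := by
  have := hG.finite
  have := h.finite
  have hN := hG.noIsolated
  have hvl : ¬ IsLeafVert T (φ v) := h.not_isLeafVert_vertex hN ⟨0, rfl⟩
  have hold : ∀ a, IsLeafVert T (φ a) → a ≠ v ∧ IsLeafVert G a := fun a ha => by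
    have hav : a ≠ v := by
      rintro rfl
      exact hvl ha
    exact ⟨hav, (h.isLeafVert_old_iff hav).1 ha⟩
  have hnew : ∀ a, a ≠ v → ∀ x, T.Adj (φ a) x → ∃ b, φ b = x := fun a ha x hx => by
    rcases h.cover x with hx' | ⟨i, rfl⟩
    · exact hx'
    · exact absurd ((h.adj_mix a i).1 hx).1 ha
  have hub := h.subToid_three_le hN
  have hrep : ∀ C F, SemiDom T {φ v} C F → subToid G + 4 ≤ C.ncard + F.ncard := fun C F hd => by
    have h1 := h.restrict_three hd
    have h2 := hG.repair _ _ (h.restrict hd)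
    omega
  have hlb : subToid G + 4 ≤ subToid T := by
    obtain ⟨C, F, hd, hc⟩ := exists_subToid (h.noIsolated_of hN)
    have := hrep C F (hd.mono (Set.empty_subset _))
    omega
  have hold_pendant : ∀ w y z, y ≠ v → PendantAt T w (φ y) z →
      ∃ w' z', φ w' = w ∧ φ z' = z ∧ PendantAt G w' y z' := by
    rintro w y z hyv ⟨hz, hyz, hyw, hwz, hy⟩
    obtain ⟨w, rfl⟩ := hnew y hyv w hyw
    obtain ⟨z, rfl⟩ := hnew y hyv z hyz
    exact ⟨w, z, rfl, rfl, (hold z hz).2, (h.adj_old y z).1 hyz, (h.adj_old y w).1 hyw,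
      fun hc => hwz (by rw [hc]), fun x hx =>
        (hy (φ x) ((h.adj_old y x).2 hx)).imp (fun hc => h.inj_old hc) (fun hc => h.inj_old hc)⟩
  have hp0 := h.not_isLeafVert_zero
  have hp1 := h.not_isLeafVert_one
  have hp0s : ¬ IsSupportVert T (p 0) := by
    rintro ⟨x, hx, hxl⟩
    rcases h.adj_zero hx with rfl | rfl
    exacts [hvl hxl, hp1 hxl]
  refine ⟨⟨this, h.noIsolated_of hN, ?_, ?_, ?_⟩, ?_, ?_, h.not_isStrongLeaf_vertex_three hN⟩
  · have h1 := (h.gap_three hN).1 hG.not_isStrongLeaf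
    have h2 := hG.gap_eq_zero
    omega
  · intro x hx
    rcases h.cover x with ⟨a, rfl⟩ | ⟨i, rfl⟩
    · obtain ⟨C, F, hd, hc, haC⟩ := hG.flexible a fun ha =>
        hx (h.isStrongLeaf_old hG.not_isStrongLeaf ha)
      obtain ⟨C', F', hd', hc', hsub, -⟩ := h.extend_three hd
      exact ⟨C', F', hd', by omega, hsub a haC⟩
    · obtain ⟨C, F, hd, hc, hvC⟩ := hG.flexible v hG.not_isStrongLeaf
      obtain ⟨C', F', hd', hc', -, h0, h1⟩ := h.extend_three hd
      obtain ⟨C₂, F₂, hd₂, hc₂, h2⟩ := h.extend_three_end hd hvC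
      fin_cases i
      · exact ⟨C', F', hd', by omega, h0⟩
      · exact ⟨C', F', hd', by omega, h1⟩
      · exact ⟨C₂, F₂, hd₂, by omega, h2⟩
  · intro w y z hP
    obtain ⟨hz, hyz, hyw, hwz, hy⟩ := id hP
    rcases h.cover y with ⟨y, rfl⟩ | ⟨i, rfl⟩
    · by_cases hyv : y = v
      · subst hyv
        have hw : p 0 = w := (hy _ h.adj_vertex_zero).resolve_right fun hc => hp0 (hc ▸ hz)
        subst hw
        refine ⟨hp0s, fun a b ha hb hay hby => ?_⟩
        rw [(h.adj_zero ha).resolve_left hay, (h.adj_zero hb).resolve_left hby]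
      · obtain ⟨w, z, rfl, rfl, hP'⟩ := hold_pendant w y z hyv hP
        obtain ⟨h1, h2⟩ := hG.pendantCond w y z hP'
        have hwv : w ≠ v := by
          rintro rfl
          exact hG.not_pendantAt y z hP'
        refine ⟨?_, ?_⟩
        · rintro ⟨x, hwx, hx⟩
          obtain ⟨x, rfl⟩ := hnew w hwv x hwx
          exact h1 ⟨x, (h.adj_old w x).1 hwx, (hold x hx).2⟩
        · intro a b ha hb hay hby
          obtain ⟨a, rfl⟩ := hnew w hwv a ha
          obtain ⟨b, rfl⟩ := hnew w hwv b hb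
          rw [h2 a b ((h.adj_old w a).1 ha) ((h.adj_old w b).1 hb) (fun hc => hay (by rw [hc]))
            (fun hc => hby (by rw [hc]))]
    · fin_cases i
      · rcases h.adj_zero hyz with rfl | rfl
        exacts [absurd hz hvl, absurd hz hp1]
      · have hzp : z = p 2 := by
          rcases h.adj_one hyz with rfl | rfl
          exacts [absurd hz hp0, rfl]
        have hwp : w = p 0 := by
          rcases h.adj_one hyw with rfl | rfl
          exacts [rfl, absurd hzp.symm hwz]
        subst hwp
        refine ⟨hp0s, fun a b ha hb hay hby => ?_⟩
        rw [(h.adj_zero ha).resolve_right hay, (h.adj_zero hb).resolve_right hby]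
      · exact absurd ((h.adj_two hyw).trans (h.adj_two hyz).symm) hwz
  · intro C F hd
    have := hrep C F hd
    omega
  · intro y z hP
    obtain ⟨hz, hyz, hyw, hwz, hy⟩ := id hP
    rcases h.cover y with ⟨y, rfl⟩ | ⟨i, rfl⟩
    · have hyv : y ≠ v := by
        rintro rfl
        exact absurd rfl hyw.ne
      obtain ⟨w, z, hw, rfl, hP'⟩ := hold_pendant _ y z hyv hP
      rw [h.inj_old hw] at hP'
      exact hG.not_pendantAt y z hP'
    · have hi : i = 0 := ((h.adj_mix' v i).1 hyw).2
      subst hi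
      rcases h.adj_zero hyz with rfl | rfl
      exacts [hvl hz, hp1 hz]

theorem attachPath_adj_inl_inl {k : ℕ} {a b : V} :
    (attachPath G v k).Adj (Sum.inl a) (Sum.inl b) ↔ G.Adj a b := by
  simp only [attachPath, fromRel_adj]
  have := fun h : G.Adj a b => h.ne
  simp [G.adj_comm b a]
  tauto

theorem attachPath_adj_inl_inr {k : ℕ} {a : V} {i : Fin k} :
    (attachPath G v k).Adj (Sum.inl a) (Sum.inr i) ↔ a = v ∧ (i : ℕ) = 0 := by
  simp [attachPath]

theorem attachPath_adj_inr_inr {k : ℕ} {i j : Fin k} :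
    (attachPath G v k).Adj (Sum.inr i) (Sum.inr j) ↔ (pathGraph k).Adj i j := by
  simp only [attachPath, fromRel_adj, pathGraph_adj]
  constructor
  · rintro ⟨-, (⟨_, _, ⟨⟩, -⟩ | ⟨a, b, ha, hb, h⟩ | ⟨_, ⟨⟩, -⟩) |
      (⟨_, _, ⟨⟩, -⟩ | ⟨a, b, ha, hb, h⟩ | ⟨_, ⟨⟩, -⟩)⟩
    · obtain rfl := Sum.inr_injective ha
      obtain rfl := Sum.inr_injective hb
      omega
    · obtain rfl := Sum.inr_injective ha
      obtain rfl := Sum.inr_injective hb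
      omega
  · intro h
    refine ⟨fun hij => ?_, ?_⟩
    · cases hij
      omega
    · rcases h with h | h
      · exact Or.inl (Or.inr (Or.inl ⟨i, j, rfl, rfl, h.symm⟩))
      · exact Or.inr (Or.inr (Or.inl ⟨j, i, rfl, rfl, h.symm⟩))

theorem attachQ_adj_inl_inl {r : ℕ} {a b : V} :
    (attachQ G v r).Adj (Sum.inl a) (Sum.inl b) ↔ G.Adj a b := by
  simp only [attachQ, fromRel_adj]
  have := fun h : G.Adj a b => h.ne
  simp [G.adj_comm b a]
  tauto

theorem attachQ_adj_inl_inr {r : ℕ} {a : V} {i : Fin r × Fin 3} :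
    (attachQ G v r).Adj (Sum.inl a) (Sum.inr i) ↔ a = v ∧ i.2 = 0 := by
  obtain ⟨i, j⟩ := i
  simp [attachQ]

theorem attachQ_adj_inr_inr {r : ℕ} {i j : Fin r × Fin 3} :
    (attachQ G v r).Adj (Sum.inr i) (Sum.inr j) ↔ i.1 = j.1 ∧ (pathGraph 3).Adj i.2 j.2 := by
  obtain ⟨i, k⟩ := i
  obtain ⟨j, l⟩ := j
  simp only [attachQ, fromRel_adj, pathGraph_adj]
  constructor
  · rintro ⟨-, (⟨_, _, ⟨⟩, -⟩ | ⟨_, ⟨⟩, -⟩ | ⟨a, b, c, ha, hb, h⟩) |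
      (⟨_, _, ⟨⟩, -⟩ | ⟨_, ⟨⟩, -⟩ | ⟨a, b, c, ha, hb, h⟩)⟩
    · obtain ⟨rfl, rfl⟩ := Prod.mk.inj (Sum.inr_injective ha)
      obtain ⟨rfl, rfl⟩ := Prod.mk.inj (Sum.inr_injective hb)
      exact ⟨rfl, Or.inl (by omega)⟩
    · obtain ⟨rfl, rfl⟩ := Prod.mk.inj (Sum.inr_injective ha)
      obtain ⟨rfl, rfl⟩ := Prod.mk.inj (Sum.inr_injective hb)
      exact ⟨rfl, Or.inr (by omega)⟩
  · rintro ⟨h, h'⟩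
    obtain rfl : i = j := h
    replace h' : (k : ℕ) + 1 = l ∨ (l : ℕ) + 1 = k := h'
    refine ⟨fun hkl => ?_, ?_⟩
    · cases hkl
      omega
    · rcases h' with h' | h'
      · exact Or.inl (Or.inr (Or.inr ⟨i, k, l, rfl, rfl, h'.symm⟩))
      · exact Or.inr (Or.inr (Or.inr ⟨i, l, k, rfl, rfl, h'.symm⟩))

theorem attPath_of_iso {k : ℕ} {j : Fin k} (hj : (j : ℕ) = 0) {U : Type u} {S : SimpleGraph U}
    (e : S ≃g attachPath G v k) :
    AttPath k j G v S (fun a => e.symm (Sum.inl a)) (fun i => e.symm (Sum.inr i)) := by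
  refine ⟨?_, fun a b => ?_, fun a b => ?_, fun a b => ?_⟩
  · convert e.symm.bijective
    ext (a | a) <;> rfl
  · rw [e.symm.map_adj_iff, attachPath_adj_inl_inl]
  · rw [e.symm.map_adj_iff, attachPath_adj_inr_inr]
  · rw [e.symm.map_adj_iff, attachPath_adj_inl_inr, Fin.ext_iff, hj]

theorem attPath_attachQ_one :
    AttPath 3 0 G v (attachQ G v 1) Sum.inl (fun k => Sum.inr (0, k)) := by
  refine ⟨⟨?_, ?_⟩, fun a b => attachQ_adj_inl_inl, fun i j => ?_, fun a i => ?_⟩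
  · rintro (a | a) (b | b) <;> simp
  · rintro (a | ⟨i, k⟩)
    · exact ⟨Sum.inl a, rfl⟩
    · exact ⟨Sum.inr k, by simp [Subsingleton.elim i 0]⟩
  · simp [attachQ_adj_inr_inr]
  · simp [attachQ_adj_inl_inr]

theorem attPath_of_iso_attachQ_succ {r : ℕ} {U : Type u} {S : SimpleGraph U}
    (e : S ≃g attachQ G v (r + 1)) :
    AttPath 3 0 (attachQ G v r) (Sum.inl v) S
      (fun a => e.symm (Sum.map id (Prod.map Fin.castSucc id) a))
      (fun k => e.symm (Sum.inr (Fin.last r, k))) := by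
  refine ⟨?_, fun a b => ?_, fun i j => ?_, fun a i => ?_⟩
  · have : Function.Bijective (Sum.elim (Sum.map id (Prod.map Fin.castSucc id))
        (fun k => Sum.inr (Fin.last r, k)) :
        (V ⊕ Fin r × Fin 3) ⊕ Fin 3 → V ⊕ Fin (r + 1) × Fin 3) := by
      constructor
      · rintro ((a | ⟨i, k⟩) | k) ((b | ⟨j, l⟩) | l) <;>
          simp [(Fin.castSucc_lt_last _).ne, (Fin.castSucc_lt_last _).ne']
      · rintro (a | ⟨i, k⟩)
        · exact ⟨Sum.inl (Sum.inl a), rfl⟩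
        · induction i using Fin.lastCases with
          | last => exact ⟨Sum.inr k, rfl⟩
          | cast i => exact ⟨Sum.inl (Sum.inr (i, k)), rfl⟩
    convert e.symm.bijective.comp this
    ext (a | a) <;> rfl
  · rw [e.symm.map_adj_iff]
    rcases a with a | a <;> rcases b with b | b
    · simp [attachQ_adj_inl_inl]
    · simp [attachQ_adj_inl_inr]
    · rw [adj_comm, (attachQ G v r).adj_comm]
      simp [attachQ_adj_inl_inr]
    · simp [attachQ_adj_inr_inr]
  · rw [e.symm.map_adj_iff]
    simp [attachQ_adj_inr_inr]
  · rw [e.symm.map_adj_iff]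
    rcases a with a | a
    · simp [attachQ_adj_inl_inr]
    · simp [attachQ_adj_inr_inr, (Fin.castSucc_lt_last _).ne]

theorem tightAt_attachQ (h : TightAt G v) (r : ℕ) : TightAt (attachQ G v (r + 1)) (Sum.inl v) := by
  induction r with
  | zero => exact attPath_attachQ_one.tightAt_three h
  | succ r ih => exact (attPath_of_iso_attachQ_succ Iso.refl).tightAt_three ih

theorem noIsolated_attachQ (h : NoIsolated G) (r : ℕ) : NoIsolated (attachQ G v (r + 1)) := by
  induction r with
  | zero => exact attPath_attachQ_one.noIsolated_of h
  | succ r ih => exact (attPath_of_iso_attachQ_succ Iso.refl).noIsolated_of ih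

theorem gap_le_attachQ [Finite V] (h : NoIsolated G) (r : ℕ) :
    gap G ≤ gap (attachQ G v (r + 1)) ∧
      (IsStrongLeaf G v → gap G < gap (attachQ G v (r + 1))) := by
  induction r with
  | zero => exact attPath_attachQ_one.gap_le_three h
  | succ r ih =>
    have := ((attPath_of_iso_attachQ_succ (G := G) (v := v) (r := r + 1) Iso.refl).gap_le_three
      (noIsolated_attachQ h r)).1
    exact ⟨ih.1.trans this, fun hv => (ih.2 hv).trans_le this⟩

theorem gap_le_of_iso_attachQ [Finite V] (h : NoIsolated G) {r : ℕ} (hr : 2 ≤ r) {U : Type u}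
    [Finite U] {S : SimpleGraph U} (e : S ≃g attachQ G v r) :
    gap G ≤ gap S ∧ (IsStrongLeaf G v → gap G < gap S) := by
  obtain ⟨s, rfl⟩ := Nat.exists_eq_add_of_le' hr
  have h1 := ((attPath_of_iso_attachQ_succ e).gap_le_three (noIsolated_attachQ h s)).1
  have h2 := gap_le_attachQ (v := v) h s
  exact ⟨h2.1.trans h1, fun hv => (h2.2 hv).trans_le h1⟩

theorem InFamilyT.tight (h : InFamilyT G) : Tight G := by
  induction h with
  | base G e =>
    have : Finite _ := Finite.of_equiv _ e.symm.toEquiv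
    refine tight_of_card_eq_two (by simp [Nat.card_congr e.toEquiv]) fun x => ?_
    obtain ⟨y, hy⟩ : ∃ y, (pathGraph 2).Adj (e x) y := by
      generalize e x = i
      simp only [pathGraph_adj]
      revert i
      decide
    refine ⟨e.symm y, ?_⟩
    rw [← e.map_adj_iff]
    simpa using hy
  | op1 hv _ G e ih => exact (attPath_of_iso (j := 0) rfl e).tight_one ih hv
  | op2 hv _ G e ih =>
    refine ((attPath_of_iso (j := 0) rfl e).tightAt_three ?_).toTight
    rcases hv with hv | hv
    exacts [ih.tightAt_of_isSupportVert hv, ih.tightAt_of_isWeakLeaf hv]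
  | op3 hv _ hr G e ih =>
    obtain ⟨s, rfl⟩ := Nat.exists_eq_add_of_le' hr
    exact ((attPath_of_iso_attachQ_succ e).tightAt_three
      (tightAt_attachQ (ih.tightAt_of_isWeakLeaf hv) s)).toTight

end Tight

section Removal

variable {V W : Type u} {ι : Type*} {H : SimpleGraph ι} {r : ι → Prop} {G : SimpleGraph V}
  {v : V} {T : SimpleGraph W} {φ : V → W} {p : ι → W}

/-- Removing the vertices in the range of `p`, which are joined to the rest of `T` only through
`v`. -/
theorem att_induce {v : W} (hp : Function.Injective p) (hv : v ∉ Set.range p)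
    (hadj : ∀ i w, T.Adj (p i) w ↔ (∃ j, H.Adj i j ∧ w = p j) ∨ (r i ∧ w = v)) :
    Att H r (T.induce (Set.range p)ᶜ) ⟨v, hv⟩ T Subtype.val p := by
  refine ⟨⟨?_, ?_⟩, fun a b => Iff.rfl, fun i j => ?_, fun a i => ?_⟩
  · rintro (a | i) (b | j) h
    · exact congrArg _ (Subtype.ext h)
    · exact absurd ⟨j, h.symm⟩ a.2
    · exact absurd ⟨i, h⟩ b.2
    · exact congrArg _ (hp h)
  · intro w
    by_cases hw : w ∈ Set.range p
    · obtain ⟨i, rfl⟩ := hw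
      exact ⟨Sum.inr i, rfl⟩
    · exact ⟨Sum.inl ⟨w, hw⟩, rfl⟩
  · rw [hadj]
    constructor
    · rintro (⟨k, hk, hjk⟩ | ⟨-, h⟩)
      · rwa [hp hjk]
      · exact absurd ⟨j, h⟩ hv
    · exact fun h => Or.inl ⟨j, h, rfl⟩
  · rw [T.adj_comm, hadj]
    constructor
    · rintro (⟨k, -, hk⟩ | ⟨hi, h⟩)
      · exact absurd ⟨k, hk.symm⟩ a.2
      · exact ⟨Subtype.ext h, hi⟩
    · rintro ⟨h, hi⟩
      exact Or.inr ⟨hi, congrArg Subtype.val h⟩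

theorem Att.nonempty_iso (h : Att H r G v T φ p) {K : SimpleGraph (V ⊕ ι)}
    (h1 : ∀ a b, K.Adj (Sum.inl a) (Sum.inl b) ↔ G.Adj a b)
    (h2 : ∀ i j, K.Adj (Sum.inr i) (Sum.inr j) ↔ H.Adj i j)
    (h3 : ∀ a i, K.Adj (Sum.inl a) (Sum.inr i) ↔ a = v ∧ r i) : Nonempty (T ≃g K) := by
  refine ⟨RelIso.symm ⟨Equiv.ofBijective _ h.bij, ?_⟩⟩
  rintro (a | i) (b | j)
  · exact (h.adj_old a b).trans (h1 a b).symm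
  · exact (h.adj_mix a j).trans (h3 a j).symm
  · rw [K.adj_comm]
    exact (h.adj_mix' b i).trans (h3 b i).symm
  · exact (h.adj_new i j).trans (h2 i j).symm

theorem AttPath.nonempty_iso {k : ℕ} {j : Fin k} (hj : (j : ℕ) = 0) {p : Fin k → W}
    (h : AttPath k j G v T φ p) : Nonempty (T ≃g attachPath G v k) :=
  Att.nonempty_iso h (fun _ _ => attachPath_adj_inl_inl) (fun _ _ => attachPath_adj_inr_inr)
    fun a i => by rw [attachPath_adj_inl_inr, Fin.ext_iff, hj]

end Removal

/-- A depth function of a tree with root `ρ`. -/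
structure IsDepth {W : Type*} (T : SimpleGraph W) (ρ : W) (d : W → ℕ) : Prop where
  root : d ρ = 0
  adj : ∀ u w, T.Adj u w → d u = d w + 1 ∨ d w = d u + 1
  exists_parent : ∀ w, w ≠ ρ → ∃ u, T.Adj w u ∧ d w = d u + 1
  parent_unique : ∀ w u u', T.Adj w u → T.Adj w u' → d w = d u + 1 → d w = d u' + 1 → u = u'

theorem SimpleGraph.IsTree.isDepth {W : Type*} {T : SimpleGraph W} (hT : T.IsTree) (ρ : W) :
    IsDepth T ρ (T.dist ρ) := by
  refine ⟨T.dist_self, fun u w h => hT.dist_eq_dist_add_one_of_adj ρ h, fun w hw => ?_,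
    fun w u u' hu hu' h h' => ?_⟩
  · obtain ⟨q, hq⟩ := hT.connected.exists_walk_length_eq_dist w ρ
    cases q with
    | nil => exact absurd rfl hw
    | cons h q =>
      rename_i u
      refine ⟨u, h, ?_⟩
      have h1 := T.dist_le q
      rw [Walk.length_cons, T.dist_comm] at hq
      rw [T.dist_comm] at h1
      rcases hT.dist_eq_dist_add_one_of_adj ρ h with h2 | h2
      · exact h2
      · omega
  · obtain ⟨q, hq⟩ := hT.connected.exists_walk_length_eq_dist ρ u
    obtain ⟨q', hq'⟩ := hT.connected.exists_walk_length_eq_dist ρ u'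
    have h1 := (q.concat hu.symm).isPath_of_length_eq_dist (by rw [Walk.length_concat, hq, h])
    have h2 := (q'.concat hu'.symm).isPath_of_length_eq_dist (by rw [Walk.length_concat, hq', h'])
    have := (hT.existsUnique_path ρ w).unique h1 h2
    simpa using congrArg Walk.penultimate this

section Depth

variable {W : Type u} {T : SimpleGraph W} {ρ : W} {d : W → ℕ}

namespace IsDepth

variable (hd : IsDepth T ρ d)
include hd

/-- A neighbor different from the parent lies one level deeper. -/
theorem child {w u x : W} (hu : T.Adj w u) (hdu : d w = d u + 1) (hx : T.Adj w x) (hxu : x ≠ u) :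
    d x = d w + 1 := by
  rcases hd.adj w x hx with h | h
  · exact absurd (hd.parent_unique w x u hx hu h hdu) hxu
  · exact h

theorem isLeafVert_of_forall_le {w : W} (hw : w ≠ ρ) (hm : ∀ x, d x ≤ d w) : IsLeafVert T w := by
  obtain ⟨u, hu, hdu⟩ := hd.exists_parent w hw
  refine isLeafVert_of hu fun x hx => by_contra fun hxu => ?_
  have := hd.child hu hdu hx hxu
  have := hm x
  omega

theorem exists_child {w : W} (hw : w ≠ ρ) (hl : ¬ IsLeafVert T w) :
    ∃ x, T.Adj w x ∧ d x = d w + 1 := by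
  obtain ⟨u, hu, hdu⟩ := hd.exists_parent w hw
  by_contra! hc
  exact hl (isLeafVert_of hu fun x hx => by_contra fun hxu => hc x hx (hd.child hu hdu hx hxu))

/-- A non-leaf on the last but one level of a tree without strong support vertices. -/
theorem last_but_one (hs : ∀ x, ¬ IsStrongSupportVert T x) {x₁ : W} (h0 : x₁ ≠ ρ)
    (hm : ∀ x, d x ≤ d x₁ + 1) (hl : ¬ IsLeafVert T x₁) :
    ∃ x₀ x₂, T.Adj x₁ x₀ ∧ T.Adj x₁ x₂ ∧ x₀ ≠ x₂ ∧ IsLeafVert T x₀ ∧ d x₀ = d x₁ + 1 ∧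
      d x₁ = d x₂ + 1 ∧ ∀ x, T.Adj x₁ x → x = x₀ ∨ x = x₂ := by
  obtain ⟨x₂, h2, hd2⟩ := hd.exists_parent x₁ h0
  obtain ⟨x₀, h1, hd1⟩ := hd.exists_child h0 hl
  have leaf : ∀ x, d x = d x₁ + 1 → IsLeafVert T x := fun x hx =>
    hd.isLeafVert_of_forall_le (fun hc => by rw [hc, hd.root] at hx; omega) fun y => by
      rw [hx]; exact hm y
  refine ⟨x₀, x₂, h1, h2, fun hc => by rw [hc] at hd1; omega, leaf x₀ hd1, hd1, hd2,
    fun x hx => ?_⟩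
  by_contra! hne
  exact hs x₁ ⟨x₀, x, hne.1.symm, h1, hx, leaf x₀ hd1, leaf x (hd.child h2 hd2 hx hne.2)⟩

end IsDepth

end Depth

theorem SimpleGraph.IsTree.noIsolated {W : Type u} {T : SimpleGraph W} (hT : T.IsTree)
    [Nontrivial W] : NoIsolated T := fun v => by
  obtain ⟨w, hw⟩ := exists_ne v
  obtain ⟨q⟩ := hT.connected v w
  cases q with
  | nil => exact absurd rfl hw
  | cons h _ => exact ⟨_, h⟩

theorem SimpleGraph.IsTree.exists_isLeafVert {W : Type u} [Finite W] {T : SimpleGraph W}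
    (hT : T.IsTree) [Nontrivial W] : ∃ v, IsLeafVert T v := by
  classical
  have := Fintype.ofFinite W
  obtain ⟨v, hv⟩ := hT.exists_vert_degree_one_of_nontrivial
  exact ⟨v, degree_eq_one_iff_existsUnique_adj.1 hv⟩

/-- The gap of `G` is nonnegative, and it vanishes only if `G` belongs to the family `𝒯`. -/
def BoundHolds {V : Type u} (G : SimpleGraph V) : Prop :=
  0 ≤ gap G ∧ (gap G = 0 → InFamilyT G)

/-- The bound holds for all trees with fewer vertices than `W`. -/
def SmallerBound (W : Type u) : Prop :=
  ∀ (V : Type u) [Finite V] (G : SimpleGraph V), Nontrivial V → G.IsTree →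
    Nat.card V < Nat.card W → BoundHolds G

/-- A tree with nonpositive gap and without strong support vertices, such that the bound holds for
all smaller trees. -/
structure Critical {W : Type u} (T : SimpleGraph W) : Prop where
  isTree : T.IsTree
  smaller : SmallerBound W
  gap_nonpos : gap T ≤ 0
  not_strong : ∀ x, ¬ IsStrongSupportVert T x

section Reduction

variable {V W : Type u} {ι : Type*} {H : SimpleGraph ι} {r : ι → Prop} {G : SimpleGraph V}
  {v : V} {T : SimpleGraph W} {φ : V → W} {p : ι → W}

theorem Att.boundHolds [Finite W] [Nonempty ι] [Nontrivial V] (h : Att H r G v T φ p)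
    (hT : T.IsTree) (hs : SmallerBound W) : BoundHolds G := by
  have := h.finite_old
  have := h.finite_new
  have h1 := h.card
  have h2 : 0 < Nat.card ι := Nat.card_pos
  exact hs V G inferInstance (h.isTree hT) (by omega)

theorem boundHolds_of_isStrongSupportVert [Finite W] (hT : T.IsTree) (hs : SmallerBound W) {s : W}
    (h : IsStrongSupportVert T s) : BoundHolds T := by
  obtain ⟨x, y, hxy, hsx, hsy, hx, hy⟩ := h
  have ms : s ∉ Set.range fun _ : Fin 1 => x := fun ⟨_, h⟩ => hsx.ne' h
  have my : y ∉ Set.range fun _ : Fin 1 => x := fun ⟨_, h⟩ => hxy h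
  have h : AttPath 1 0 (T.induce (Set.range fun _ : Fin 1 => x)ᶜ)
      ⟨s, ms⟩ T Subtype.val (fun _ => x) := by
    refine att_induce (fun _ _ _ => Subsingleton.elim _ _) _ fun i w => ?_
    rw [Subsingleton.elim i 0]
    constructor
    · exact fun hw => Or.inr ⟨rfl, hx.eq hw hsx.symm⟩
    · rintro (⟨j, hj, -⟩ | ⟨-, rfl⟩)
      · exact absurd (Subsingleton.elim _ _) hj.ne
      · exact hsx.symm
  have hsG : IsSupportVert (T.induce (Set.range fun _ : Fin 1 => x)ᶜ)
      ⟨s, ms⟩ :=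
    ⟨⟨y, my⟩, hsy,
    (h.isLeafVert_old_iff (fun hc => hsy.ne (congrArg Subtype.val hc).symm)).1 hy⟩
  have : Nontrivial ↥(Set.range fun _ : Fin 1 => x)ᶜ := ⟨⟨s, ms⟩, ⟨y, my⟩,
    fun hc => hsy.ne (congrArg Subtype.val hc)⟩
  have hG := (h.isTree hT).noIsolated
  have hb := h.boundHolds hT hs
  have h1 := h.subToid_one_le hG hsG
  have h2 := h.gap_one hG hsG
  refine ⟨by have := hb.1; omega, fun h0 => ?_⟩
  obtain ⟨e⟩ := AttPath.nonempty_iso rfl h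
  exact .op1 hsG (hb.2 (by have := hb.1; omega)) T e

end Reduction

section Critical

variable {W : Type u} {T : SimpleGraph W} {ρ : W} {d : W → ℕ}

theorem Critical.unique_child [Finite W] (hT : Critical T) (hd : IsDepth T ρ d) {x₁ x₂ : W}
    (h₁ : x₁ ≠ ρ) (h₂ : x₂ ≠ ρ) (hm : ∀ x, d x ≤ d x₁ + 1) (hl : ¬ IsLeafVert T x₁)
    (h12 : T.Adj x₁ x₂) (hd12 : d x₁ = d x₂ + 1) :
    ¬ IsSupportVert T x₂ ∧ ∀ y, T.Adj x₂ y → y = x₁ ∨ d x₂ = d y + 1 := by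
  obtain ⟨x₀, x₂', h10, h12', hne, hx₀, hd0, hd12', hN⟩ := hd.last_but_one hT.not_strong h₁ hm hl
  obtain rfl := hd.parent_unique _ _ _ h12 h12' hd12 hd12'
  obtain ⟨x₃, h23, hd23⟩ := hd.exists_parent x₂ h₂
  have ne_of_d : ∀ {a b : W}, d a ≠ d b → a ≠ b := fun h hab => h (congrArg d hab)
  have mem : ∀ a, a ≠ x₁ → a ≠ x₀ → a ∉ Set.range ![x₁, x₀] := by
    intro a h1 h2
    simpa using ⟨h2, h1⟩
  have m2 := mem x₂ h12.ne' hne.symm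
  have h : AttPath 2 0 (T.induce (Set.range ![x₁, x₀])ᶜ) ⟨x₂, m2⟩ T Subtype.val ![x₁, x₀] := by
    refine att_induce ?_ _ fun i w => ?_
    · simp [Function.Injective, Fin.forall_fin_succ, h10.ne, h10.ne']
    · have e1 : T.Adj x₁ w ↔ w = x₀ ∨ w = x₂ :=
        ⟨hN w, by rintro (rfl | rfl) <;> assumption⟩
      have e0 : T.Adj x₀ w ↔ w = x₁ :=
        ⟨fun hw => hx₀.eq hw h10.symm, by rintro rfl; exact h10.symm⟩
      fin_cases i <;> simp [Fin.exists_fin_succ, pathGraph_adj, e1, e0]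
  have m3 := mem x₃ (ne_of_d (by omega)) (ne_of_d (by omega))
  have : Nontrivial ↥(Set.range ![x₁, x₀])ᶜ := ⟨⟨x₂, m2⟩, ⟨x₃, m3⟩,
    fun hc => h23.ne (congrArg Subtype.val hc)⟩
  have hG := (h.isTree hT.isTree).noIsolated
  have hb := h.boundHolds hT.isTree hT.smaller
  have := h.finite_old
  have key := fun hv hs => not_lt_of_ge (hT.gap_nonpos.trans hb.1) (h.gap_lt_two hG hv hs)
  have hsupp : ¬ IsSupportVert T x₂ := by
    rintro ⟨z, h2z, hz⟩
    have mz := mem z (fun hc => hl (hc ▸ hz)) (fun hc => by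
      rcases hd.adj _ _ h2z with h | h <;> rw [hc] at h <;> omega)
    have : IsSupportVert (T.induce (Set.range ![x₁, x₀])ᶜ) ⟨x₂, m2⟩ := ⟨⟨z, mz⟩, h2z,
      (h.isLeafVert_old_iff (fun hc => h2z.ne (congrArg Subtype.val hc).symm)).1 hz⟩
    exact key (exists_subToid_mem_support hG this) this.not_isStrongLeaf
  refine ⟨hsupp, fun y h2y => ?_⟩
  by_contra! hy
  have hdy : d y = d x₂ + 1 := (hd.adj _ _ h2y).resolve_left hy.2
  obtain ⟨z, x₂', hyz, hy2, hz2, hz, hdz, hd2', hNy⟩ := hd.last_but_one hT.not_strong (x₁ := y)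
    (ne_of_d (by rw [hd.root]; omega)) (fun x => by have := hm x; omega)
    (fun hc => hsupp ⟨y, h2y, hc⟩)
  obtain rfl := hd.parent_unique _ _ _ h2y.symm hy2 hdy hd2'
  have my := mem y hy.1 (ne_of_d (by omega))
  have mz := mem z (ne_of_d (by omega)) (by
    rintro rfl
    exact hy.1 (hz.eq hyz.symm h10.symm))
  refine key (exists_subToid_mem_pendant hG (x := ⟨x₃, m3⟩) (y := ⟨y, my⟩) (z := ⟨z, mz⟩) h23 h2y
    (fun hc => ne_of_d (a := x₃) (b := y) (by omega) (congrArg Subtype.val hc)) hyz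
    ((h.isLeafVert_old_iff (fun hc => hz2 (congrArg Subtype.val hc))).1 hz)
    (fun a ha => ?_) (fun hc => hz2 (congrArg Subtype.val hc).symm)) fun hc =>
      not_isLeafVert_of (a := ⟨x₃, m3⟩) (b := ⟨y, my⟩) h23 h2y
        (fun hc => ne_of_d (a := x₃) (b := y) (by omega) (congrArg Subtype.val hc)) hc.1
  rcases hNy a ha with h | h
  · exact Or.inr (Subtype.ext h)
  · exact Or.inl (Subtype.ext h)

/-- The path `c b a` is a branch of `T` below `x`. -/
structure IsBranch {W : Type u} (T : SimpleGraph W) (d : W → ℕ) (x c b a : W) : Prop where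
  adj_c : ∀ w, T.Adj c w ↔ w = x ∨ w = b
  adj_b : ∀ w, T.Adj b w ↔ w = c ∨ w = a
  adj_a : ∀ w, T.Adj a w ↔ w = b
  depth_c : d c = d x + 1
  depth_b : d b = d x + 2
  depth_a : d a = d x + 3

theorem Critical.exists_isBranch [Finite W] (hT : Critical T) (hd : IsDepth T ρ d) {x c : W}
    (hm : ∀ y, d y ≤ d x + 3) (hxc : T.Adj x c) (hdc : d c = d x + 1) (hl : ¬ IsLeafVert T c)
    (hs : ¬ IsSupportVert T c) : ∃ b a, IsBranch T d x c b a := by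
  have ne_root : ∀ {a : W}, d a ≠ 0 → a ≠ ρ := fun h ha => h (by rw [ha, hd.root])
  have hc : c ≠ ρ := ne_root (by omega)
  obtain ⟨b, hcb, hdb⟩ := hd.exists_child hc hl
  have hb : b ≠ ρ := ne_root (by omega)
  have hmb : ∀ y, d y ≤ d b + 1 := fun y => by have := hm y; omega
  have hbl : ¬ IsLeafVert T b := fun h => hs ⟨b, hcb, h⟩
  have hu := (hT.unique_child hd hb hc hmb hbl hcb.symm hdb).2
  obtain ⟨a, c', hba, hbc', -, ha, hda, hdb', hN⟩ := hd.last_but_one hT.not_strong hb hmb hbl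
  obtain rfl := hd.parent_unique _ _ _ hcb.symm hbc' hdb hdb'
  refine ⟨b, a, fun w => ⟨fun hw => ?_, ?_⟩, fun w => ⟨fun hw => (hN w hw).symm, ?_⟩,
    fun w => ⟨fun hw => ha.eq hw hba.symm, ?_⟩, hdc, by omega, by omega⟩
  · rcases hu w hw with h | h
    · exact Or.inr h
    · exact Or.inl (hd.parent_unique _ _ _ hw hxc.symm h hdc)
  · rintro (rfl | rfl)
    exacts [hxc.symm, hcb]
  · rintro (rfl | rfl)
    exacts [hcb.symm, hba]
  · rintro rfl
    exact hba.symm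

theorem IsBranch.notMem {x c b a w : W} (h : IsBranch T d x c b a) (hw : w ≠ c)
    (hdw : d w ≤ d x + 1) : w ∉ Set.range ![c, b, a] := by
  have h1 := h.depth_b
  have h2 := h.depth_a
  simp only [Matrix.range_cons, Matrix.range_empty, Set.union_empty, Set.singleton_union,
    Set.mem_insert_iff, Set.mem_singleton_iff, not_or]
  exact ⟨hw, by rintro rfl; omega, by rintro rfl; omega⟩

theorem IsBranch.notMem_self {x c b a : W} (h : IsBranch T d x c b a) :
    x ∉ Set.range ![c, b, a] :=
  h.notMem (fun hc => by have := h.depth_c; rw [hc] at this; omega) (Nat.le_succ _)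

theorem IsBranch.attPath {x c b a : W} (h : IsBranch T d x c b a) :
    AttPath 3 0 (T.induce (Set.range ![c, b, a])ᶜ) ⟨x, h.notMem_self⟩ T Subtype.val
      ![c, b, a] := by
  have h1 := h.depth_c
  have h2 := h.depth_b
  have h3 := h.depth_a
  have n1 : c ≠ b := by rintro rfl; omega
  have n2 : c ≠ a := by rintro rfl; omega
  have n3 : b ≠ a := by rintro rfl; omega
  refine att_induce ?_ _ fun i w => ?_
  · simp [Function.Injective, Fin.forall_fin_succ, n1, n2, n3, n1.symm, n2.symm, n3.symm]
  · fin_cases i <;>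
      simp [Fin.exists_fin_succ, pathGraph_adj, h.adj_c, h.adj_b, h.adj_a, or_comm]

end Critical

section Upper

variable {W : Type u} [Finite W] {T : SimpleGraph W} {ρ : W} {d : W → ℕ}

theorem Critical.not_isSupportVert_child (hT : Critical T) (hd : IsDepth T ρ d)
    {x₀ x₁ x₂ x x₄ c : W} (hm : ∀ y, d y ≤ d x + 3) (hb : IsBranch T d x x₂ x₁ x₀)
    (h4 : T.Adj x x₄) (hd4 : d x = d x₄ + 1) (hl4 : ¬ IsLeafVert T x₄)
    (hp : PendantCond (T.induce (Set.range ![x₂, x₁, x₀])ᶜ)) (hxc : T.Adj x c)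
    (hdc : d c = d x + 1) (hlc : ¬ IsLeafVert T c) : ¬ IsSupportVert T c := by
  have ne_of_d : ∀ {a b : W}, d a ≠ d b → a ≠ b := fun h hab => h (congrArg d hab)
  rintro ⟨z, hcz, hz⟩
  have hx2 : T.Adj x x₂ := ((hb.adj_c x).2 (Or.inl rfl)).symm
  have hd2 := hb.depth_c
  have hd1 := hb.depth_b
  have hd0 := hb.depth_a
  have hxz : x ≠ z := by
    rintro rfl
    exact ne_of_d (by omega) (hz.eq hx2 h4)
  have hdz : d z = d c + 1 := hd.child hxc.symm hdc hcz hxz.symm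
  have hNc : ∀ y, T.Adj c y ↔ y = x ∨ y = z := by
    refine fun y => ⟨fun hy => ?_, ?_⟩
    · by_contra! hne
      have hdy := hd.child hxc.symm hdc hy hne.1
      exact (hT.unique_child hd (x₁ := y) (x₂ := c) (ne_of_d (by rw [hd.root]; omega))
        (ne_of_d (by rw [hd.root]; omega)) (fun w => by have := hm w; omega)
        (fun hl => hT.not_strong c ⟨y, z, hne.2, hy, hcz, hl, hz⟩) hy.symm hdy).1 ⟨z, hcz, hz⟩
    · rintro (rfl | rfl)
      exacts [hxc.symm, hcz]
  have hc2 : c ≠ x₂ := by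
    rintro rfl
    have h1 : z = x₁ := ((hb.adj_c z).1 hcz).resolve_left hxz.symm
    subst h1
    exact ne_of_d (a := c) (b := x₀) (by omega)
      (hz.eq ((hb.adj_b _).2 (Or.inl rfl)) ((hb.adj_b _).2 (Or.inr rfl)))
  have hz1 : z ≠ x₁ := by
    rintro rfl
    exact hc2 (hz.eq hcz.symm ((hb.adj_b _).2 (Or.inl rfl)))
  have mz : z ∉ Set.range ![x₂, x₁, x₀] := by
    simpa [eq_comm] using ⟨ne_of_d (a := x₀) (b := z) (by omega), hz1.symm,
      ne_of_d (a := x₂) (b := z) (by omega)⟩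
  have mc := hb.notMem hc2 (by omega)
  have hpend : PendantAt (T.induce (Set.range ![x₂, x₁, x₀])ᶜ) ⟨x, hb.notMem_self⟩ ⟨c, mc⟩
      ⟨z, mz⟩ :=
    ⟨(hb.attPath.isLeafVert_old_iff (fun hc => hxz (congrArg Subtype.val hc).symm)).1 hz, hcz,
      hxc.symm, fun hc => hxz (congrArg Subtype.val hc), fun y hy =>
        ((hNc y).1 hy).imp (fun h => Subtype.ext h) fun h => Subtype.ext h⟩
  have m4 : x₄ ∉ Set.range ![x₂, x₁, x₀] := hb.notMem (ne_of_d (by omega)) (by omega)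
  have hNx : ∀ w, T.Adj x w ↔ w = c ∨ w = x₂ ∨ w = x₄ := by
    refine fun w => ⟨fun hw => ?_, ?_⟩
    · by_contra! hne
      have hdw := hd.child h4 hd4 hw hne.2.2
      have mw := hb.notMem hne.2.1 hdw.le
      exact hne.2.2 (congrArg Subtype.val ((hp _ _ _ hpend).2 ⟨w, mw⟩ ⟨x₄, m4⟩ hw h4
        (fun hc => hne.1 (congrArg Subtype.val hc))
        (fun hc => ne_of_d (a := x₄) (b := c) (by omega) (congrArg Subtype.val hc))))
    · rintro (rfl | rfl | rfl) <;> assumption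
  have hNz : ∀ w, T.Adj z w ↔ w = c := fun w =>
    ⟨fun hw => hz.eq hw hcz.symm, by rintro rfl; exact hcz.symm⟩
  have mem : ∀ w, w ≠ x → d w ≤ d x → w ∉ Set.range ![z, c, x, x₂, x₁, x₀] := by
    rintro w hw hdw ⟨i, rfl⟩
    fin_cases i <;> simp at hw hdw <;> omega
  have m4' := mem x₄ h4.ne' (by omega)
  have h : AttPath 6 2 (T.induce (Set.range ![z, c, x, x₂, x₁, x₀])ᶜ) ⟨x₄, m4'⟩ T Subtype.val
      ![z, c, x, x₂, x₁, x₀] := by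
    refine att_induce ?_ _ fun i w => ?_
    · intro i j hij
      have hij' := congrArg d hij
      fin_cases i <;> fin_cases j <;> first
        | rfl
        | (exfalso; simp at hij'; omega)
        | exact absurd hij hc2
        | exact absurd hij.symm hc2
        | exact absurd hij hz1
        | exact absurd hij.symm hz1
    · fin_cases i <;>
        simp [Fin.exists_fin_succ, pathGraph_adj, hNx, hNc, hNz, hb.adj_c, hb.adj_b, hb.adj_a] <;>
        tauto
  obtain ⟨u, h4u, hux⟩ : ∃ u, T.Adj x₄ u ∧ u ≠ x := by
    by_contra! hc
    exact hl4 (isLeafVert_of h4.symm hc)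
  have mu := mem u hux (by rcases hd.adj _ _ h4u with h | h <;> omega)
  have : Nontrivial ↥(Set.range ![z, c, x, x₂, x₁, x₀])ᶜ := ⟨⟨x₄, m4'⟩, ⟨u, mu⟩,
    fun hc => h4u.ne (congrArg Subtype.val hc)⟩
  have hG := (h.isTree hT.isTree).noIsolated
  have hbd := h.boundHolds hT.isTree hT.smaller
  have := h.finite_old
  have h6 := h.gap_le_six hG
  have h0 := hT.gap_nonpos
  have hs : ¬ IsStrongLeaf _ _ := fun hs => by
    have := h6.2 hs
    have := hbd.1
    omega
  have hmem := (hbd.2 (le_antisymm (h6.1.trans h0) hbd.1)).tight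
  have := h.gap_lt_six hG (hmem.flexible _ hs) hs
  have := hbd.1
  omega

theorem Critical.boundHolds_of_forall_isBranch (hT : Critical T)
    {x x₄ c₁ c₂ : W} (h4 : T.Adj x x₄) (hd4 : d x = d x₄ + 1) (h1 : T.Adj x c₁) (h2 : T.Adj x c₂)
    (h12 : c₁ ≠ c₂) (h14 : c₁ ≠ x₄) (h24 : c₂ ≠ x₄)
    (hb : ∀ c, T.Adj x c → c ≠ x₄ → ∃ b a, IsBranch T d x c b a) : BoundHolds T := by
  let S := {c // T.Adj x c ∧ c ≠ x₄}
  have hb' : ∀ c : S, ∃ b a, IsBranch T d x c b a := fun c => hb c c.2.1 c.2.2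
  choose b a hba using hb'
  obtain ⟨r, ⟨e⟩⟩ := Finite.exists_equiv_fin S
  have hr : 2 ≤ r := by
    have : Nontrivial S := ⟨⟨c₁, h1, h14⟩, ⟨c₂, h2, h24⟩, fun hc => h12 (congrArg Subtype.val hc)⟩
    have := Finite.one_lt_card (α := S)
    rw [Nat.card_congr e, Nat.card_fin] at this
    exact this
  let p : Fin r × Fin 3 → W := fun i => ![(e.symm i.1 : W), b (e.symm i.1), a (e.symm i.1)] i.2
  have hdp : ∀ i, d (p i) = d x + 1 + i.2 := by
    rintro ⟨i, k⟩
    have := hba (e.symm i)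
    have h1 := this.depth_c
    have h2 := this.depth_b
    have h3 := this.depth_a
    fin_cases k <;> simp [p, h1, h2, h3]
  have mem : ∀ w, d w ≤ d x → w ∉ Set.range p := by
    rintro w hw ⟨i, rfl⟩
    rw [hdp] at hw
    omega
  have hinj : Function.Injective p := by
    rintro ⟨i, k⟩ ⟨j, l⟩ h
    have hk := congrArg d h
    rw [hdp, hdp] at hk
    obtain rfl : k = l := Fin.ext (by simpa using hk)
    suffices hs : ∀ s t : S, ![(s : W), b s, a s] k = ![(t : W), b t, a t] k → s = t by
      rw [show i = j from e.symm.injective (hs _ _ h)]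
    intro s t hst
    have hb1 : b s = b t → s = t := fun hst => by
      have := ((hba s).adj_b t).1 (hst ▸ ((hba t).adj_b t).2 (Or.inl rfl))
      refine Subtype.ext (this.resolve_right fun hc => ?_).symm
      have h1 := (hba t).depth_c
      have h2 := (hba s).depth_a
      rw [hc] at h1
      omega
    fin_cases k
    · exact Subtype.ext hst
    · exact hb1 hst
    · have : a s = a t := hst
      exact hb1 (((hba t).adj_a (b s)).1 (this ▸ ((hba s).adj_a (b s)).2 rfl))
  have h : Att ((⊥ : SimpleGraph (Fin r)) □ pathGraph 3) (fun i => i.2 = 0)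
      (T.induce (Set.range p)ᶜ) ⟨x, mem x le_rfl⟩ T Subtype.val p := by
    refine att_induce hinj _ ?_
    rintro ⟨i, k⟩ w
    have := hba (e.symm i)
    fin_cases k <;>
      simp [p, boxProd_adj, Fin.exists_fin_succ, pathGraph_adj, this.adj_c, this.adj_b, this.adj_a,
        or_comm, exists_or]
  have m4 := mem x₄ (by omega)
  have : Nontrivial ↥(Set.range p)ᶜ := ⟨⟨x, mem x le_rfl⟩, ⟨x₄, m4⟩,
    fun hc => h4.ne (congrArg Subtype.val hc)⟩
  have : Nonempty (Fin r × Fin 3) := ⟨(⟨0, by omega⟩, 0)⟩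
  have hG := (h.isTree hT.isTree).noIsolated
  have hbd := h.boundHolds hT.isTree hT.smaller
  have := h.finite_old
  obtain ⟨ψ⟩ := h.nonempty_iso (K := attachQ _ _ r) (fun _ _ => attachQ_adj_inl_inl)
    (fun i j => by rw [attachQ_adj_inr_inr, boxProd_adj]; simp [and_comm])
    fun _ _ => attachQ_adj_inl_inr
  have hgap := gap_le_of_iso_attachQ hG hr ψ
  have h0 := hT.gap_nonpos
  have hw : IsWeakLeaf (T.induce (Set.range p)ᶜ) ⟨x, mem x le_rfl⟩ := by
    refine ⟨isLeafVert_of (a := ⟨x₄, m4⟩) h4 fun w hw => Subtype.ext ?_, fun hs => ?_⟩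
    · by_contra hne
      exact w.2 ⟨(e ⟨w, hw, hne⟩, 0), by simp [p]⟩
    · have := hgap.2 hs
      have := hbd.1
      omega
  exact ⟨hbd.1.trans hgap.1, fun _ => .op3 hw
    (hbd.2 (le_antisymm (hgap.1.trans h0) hbd.1)) hr T ψ⟩

theorem Critical.boundHolds (hT : Critical T) (hc : 2 < Nat.card W) : BoundHolds T := by
  have : Nontrivial W := Finite.one_lt_card_iff_nontrivial.1 (by omega)
  obtain ⟨ρ, hρ⟩ := hT.isTree.exists_isLeafVert
  have hd := hT.isTree.isDepth ρ
  generalize T.dist ρ = d at hd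
  obtain ⟨x₀, hx₀⟩ := Finite.exists_max d
  have hroot : ∀ {y : W}, d y ≠ 0 → y ≠ ρ := fun h hy => h (by rw [hy, hd.root])
  have hroot' : ∀ {y : W}, d y = 0 → y = ρ := fun h => by
    by_contra hy
    obtain ⟨u, -, hu⟩ := hd.exists_parent _ hy
    omega
  have ne_of_d : ∀ {a b : W}, d a ≠ d b → a ≠ b := fun h hab => h (congrArg d hab)
  have h0 : x₀ ≠ ρ := by
    obtain ⟨y, hy⟩ := exists_ne ρ
    obtain ⟨u, -, hu⟩ := hd.exists_parent y hy
    have := hx₀ y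
    exact hroot (by omega)
  obtain ⟨x₁, h01, hd01⟩ := hd.exists_parent x₀ h0
  have h1 : x₁ ≠ ρ := by
    rintro rfl
    have hcard : (Set.univ : Set W) ⊆ {x₁, x₀} := by
      intro w _
      by_contra! hw
      simp only [Set.mem_insert_iff, Set.mem_singleton_iff, not_or] at hw
      obtain ⟨u, hu, hdu⟩ := hd.exists_parent w hw.1
      have := hx₀ w
      have := hd.root
      obtain rfl := hroot' (y := u) (by omega)
      exact hw.2 (hρ.eq hu.symm h01.symm)
    have := (Set.ncard_le_ncard hcard).trans (ncard_pair_le _ _)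
    rw [Set.ncard_univ] at this
    omega
  have hm1 : ∀ y, d y ≤ d x₁ + 1 := fun y => hd01 ▸ hx₀ y
  obtain ⟨x₂, h12, hd12⟩ := hd.exists_parent x₁ h1
  have hl1 : ¬ IsLeafVert T x₁ := not_isLeafVert_of h01.symm h12 (ne_of_d (by omega))
  have h2 : x₂ ≠ ρ := by
    rintro rfl
    obtain ⟨z, u, hz, -, -, hzl, hdz, -, -⟩ := hd.last_but_one hT.not_strong h1 hm1 hl1
    exact hT.not_strong x₁ ⟨z, x₂, ne_of_d (by omega), hz, h12, hzl, hρ⟩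
  have hs2 := (hT.unique_child hd h1 h2 hm1 hl1 h12 hd12).1
  obtain ⟨x₃, h23, hd23⟩ := hd.exists_parent x₂ h2
  have h3 : x₃ ≠ ρ := by
    rintro rfl
    exact hs2 ⟨x₃, h23, hρ⟩
  obtain ⟨x₄, h34, hd34⟩ := hd.exists_parent x₃ h3
  have hl2 : ¬ IsLeafVert T x₂ := not_isLeafVert_of h12.symm h23 (ne_of_d (by omega))
  have hm : ∀ y, d y ≤ d x₃ + 3 := fun y => by have := hx₀ y; omega
  obtain ⟨b, a, hb⟩ := hT.exists_isBranch hd hm h23.symm hd23 hl2 hs2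
  have h := hb.attPath
  have m4 : x₄ ∉ Set.range ![x₂, b, a] := hb.notMem (ne_of_d (by omega)) (by omega)
  have : Nontrivial ↥(Set.range ![x₂, b, a])ᶜ := ⟨⟨x₃, hb.notMem_self⟩, ⟨x₄, m4⟩,
    fun hc => h34.ne (congrArg Subtype.val hc)⟩
  have hG := (h.isTree hT.isTree).noIsolated
  have hbd := h.boundHolds hT.isTree hT.smaller
  have := h.finite_old
  have hgap := h.gap_le_three hG
  have hgap0 := hT.gap_nonpos
  have hmem := hbd.2 (le_antisymm (hgap.1.trans hgap0) hbd.1)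
  by_cases hcase : IsSupportVert (T.induce (Set.range ![x₂, b, a])ᶜ) ⟨x₃, hb.notMem_self⟩ ∨
      IsLeafVert (T.induce (Set.range ![x₂, b, a])ᶜ) ⟨x₃, hb.notMem_self⟩
  · obtain ⟨ψ⟩ := AttPath.nonempty_iso rfl h
    refine ⟨hbd.1.trans hgap.1,
      fun _ => .op2 (hcase.imp_right fun hl => ⟨hl, fun hs => ?_⟩) hmem T ψ⟩
    have := hgap.2 hs
    have := hbd.1
    omega
  · rw [not_or] at hcase
    have hleaf : ∀ c, T.Adj x₃ c → ¬ IsLeafVert T c := by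
      intro c hc hl
      have hc2 : c ≠ x₂ := fun h => hl2 (h ▸ hl)
      have mc := hb.notMem hc2 (by rcases hd.adj _ _ hc with h | h <;> omega)
      exact hcase.1 ⟨⟨c, mc⟩, hc,
        (h.isLeafVert_old_iff (fun h => hc.ne (congrArg Subtype.val h).symm)).1 hl⟩
    obtain ⟨⟨c, mc⟩, hc, hc4⟩ : ∃ c : ↥(Set.range ![x₂, b, a])ᶜ,
        T.Adj x₃ c ∧ (c : W) ≠ x₄ := by
      by_contra! hne
      exact hcase.2 (isLeafVert_of (a := ⟨x₄, m4⟩) h34 fun c hc => Subtype.ext (hne c hc))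
    refine hT.boundHolds_of_forall_isBranch h34 hd34 h23.symm hc ?_ (ne_of_d (by omega)) hc4
      fun y hy hy4 => ?_
    · rintro rfl
      exact mc ⟨0, rfl⟩
    · have hdy := hd.child h34 hd34 hy hy4
      exact hT.exists_isBranch hd hm hy hdy (hleaf y hy)
        (hT.not_isSupportVert_child hd hm hb h34 hd34 (hleaf x₄ h34) hmem.tight.pendantCond hy hdy
          (hleaf y hy))

end Upper

theorem SimpleGraph.IsTree.boundHolds {W : Type u} [Finite W] [Nontrivial W] {T : SimpleGraph W}
    (hT : T.IsTree) : BoundHolds T := by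
  induction hn : Nat.card W using Nat.strong_induction_on generalizing W with
  | _ n ih =>
    have hs : SmallerBound W := fun V _ G _ hG hV => ih _ (hn ▸ hV) hG rfl
    have hc : 1 < Nat.card W := Finite.one_lt_card
    by_cases hc2 : Nat.card W = 2
    · refine ⟨(tight_of_card_eq_two hc2 hT.noIsolated).gap_eq_zero.ge, fun _ => ?_⟩
      have e : W ≃ Fin 2 := Finite.equivFinOfCardEq hc2
      refine .base T ⟨e, fun {x y} => ?_⟩
      obtain ⟨z, hxz⟩ := hT.noIsolated x
      have key : T.Adj x y ↔ x ≠ y := ⟨fun h => h.ne, fun h =>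
        (eq_or_eq_of_card_eq_two hc2 hxz.ne y).resolve_left h.symm ▸ hxz⟩
      rw [key, ← e.injective.ne_iff, pathGraph_adj, ne_eq, Fin.ext_iff]
      omega
    · by_cases hst : ∃ s, IsStrongSupportVert T s
      · obtain ⟨s, h⟩ := hst
        exact boundHolds_of_isStrongSupportVert hT hs h
      · by_cases hg : gap T ≤ 0
        · exact Critical.boundHolds ⟨hT, hs, hg, not_exists.1 hst⟩ (by omega)
        · exact ⟨by omega, fun h => absurd h.le hg⟩

theorem subToid_eq_iff_gap_eq_zero {V : Type u} [Finite V] {T : SimpleGraph V} (hT : NoIsolated T) :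
    (toidNumber (subdivision T) : ℚ) =
      (4 * (Nat.card V : ℚ) - leafCount T + supportCount T - 2) / 3 ↔ gap T = 0 := by
  have hcount : (supportCount T : ℤ) - leafCount T =
      {x | IsSupportVert T x}.ncard - {x | IsLeafVert T x}.ncard := by
    unfold supportCount leafCount
    split_ifs with hc
    · simp [isLeafVert_of_card_eq_two hc hT, isSupportVert_of_card_eq_two hc hT]
    · rfl
  have hgap : gap T = 4 * (Nat.card V : ℤ) - leafCount T + supportCount T - 2
      - 3 * toidNumber (subdivision T) := by
    rw [gap, subToid]
    omega
  rw [eq_div_iff (by norm_num), ← @Int.cast_inj ℚ, hgap]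
  push_cast
  constructor <;> intro h <;> linarith

theorem upper_equality_iff_familyT {V : Type u} [Fintype V]
    (T : SimpleGraph V) (hT : T.IsTree) (hn : 2 ≤ Nat.card V) :
    (toidNumber (subdivision T) : ℚ) = (4 * (Nat.card V : ℚ) - leafCount T + supportCount T - 2) / 3 ↔ InFamilyT T := by
  have : Nontrivial V := Finite.one_lt_card_iff_nontrivial.1 hn
  rw [subToid_eq_iff_gap_eq_zero hT.noIsolated]
  exact ⟨hT.boundHolds.2, fun h => h.tight.gap_eq_zero⟩
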